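/- arXiv:1904.08624 — 3 statements merged into one kernel-verified Lean document; each statement's English description precedes it below -/
import Mathlib

section
/- There exists a simple polygon P that has no vertex-to-vertex conflict-free chromatic guarding with 2 colours; that is, for every set G of vertices of P and every colouring χ : G → {1, 2}, some vertex p of P has no guard g ∈ G visible from p whose colour occurs exactly once among the guards of G visible from p. -/
/-- A simple polygon: a cyclic sequence of `n ≥ 3` distinct points in the plane
(`ℝ × ℝ`) whose closed edges `[vtx i, vtx (i+1)]` (indices mod `n`) are pairwise
disjoint, except that consecutive edges share exactly their common endpoint. -/
structure SimplePolygon where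
  n : ℕ
  three_le : 3 ≤ n
  vtx : Fin n → ℝ × ℝ
  inj : Function.Injective vtx
  consec_edges : ∀ i : Fin n,
    haveI : NeZero n := ⟨by omega⟩
    segment ℝ (vtx i) (vtx (i + 1)) ∩ segment ℝ (vtx (i + 1)) (vtx (i + 1 + 1))
      = {vtx (i + 1)}
  nonconsec_edges : ∀ i j : Fin n,
    haveI : NeZero n := ⟨by omega⟩
    i ≠ j → j ≠ i + 1 → i ≠ j + 1 →
      segment ℝ (vtx i) (vtx (i + 1)) ∩ segment ℝ (vtx j) (vtx (j + 1)) = ∅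

instance (P : SimplePolygon) : NeZero P.n := ⟨by have := P.three_le; omega⟩

namespace SimplePolygon

/-- The boundary of the polygon: the union of its edges. -/
def boundary (P : SimplePolygon) : Set (ℝ × ℝ) :=
  ⋃ i : Fin P.n, segment ℝ (P.vtx i) (P.vtx (i + 1))

/-- The polygon as a point set: its boundary together with the union of all
bounded connected components of the complement of the boundary. -/
def region (P : SimplePolygon) : Set (ℝ × ℝ) :=
  P.boundary ∪
    {p | p ∉ P.boundary ∧ Bornology.IsBounded (connectedComponentIn P.boundaryᶜ p)}

/-- `p` sees `q` if the closed segment between them lies in the polygon. -/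
def Sees (P : SimplePolygon) (p q : ℝ × ℝ) : Prop :=
  segment ℝ p q ⊆ P.region

/-- The planar cross product of two vectors. -/
def cross2 (a b : ℝ × ℝ) : ℝ := a.1 * b.2 - a.2 * b.1

/-- Counterclockwise orientation: positive shoelace signed area. -/
def Ccw (P : SimplePolygon) : Prop :=
  0 < ∑ i : Fin P.n, cross2 (P.vtx i) (P.vtx (i + 1))

/-- A vertex is convex if the cross product of the incoming and the outgoing
edge vectors is positive (for a counterclockwise-oriented polygon). -/
def ConvexVtx (P : SimplePolygon) (i : Fin P.n) : Prop :=
  0 < cross2 (P.vtx i - P.vtx (i - 1)) (P.vtx (i + 1) - P.vtx i)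

/-- A funnel: a counterclockwise-oriented simple polygon with exactly three
convex vertices, two of which (the endpoints of the base edge) are adjacent;
the third convex vertex is the apex. -/
def IsFunnel (P : SimplePolygon) : Prop :=
  P.Ccw ∧ ∃ b c : Fin P.n, c ≠ b ∧ c ≠ b + 1 ∧
    {i : Fin P.n | P.ConvexVtx i} = {b, b + 1, c}

/-- `G` is a set of vertices of `P` such that every point of `P` is seen by
some vertex in `G`. -/
def GuardsAll (P : SimplePolygon) (G : Finset (ℝ × ℝ)) : Prop :=
  ↑G ⊆ Set.range P.vtx ∧ ∀ p ∈ P.region, ∃ g ∈ G, P.Sees g p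

/-- A vertex-to-point conflict-free chromatic guarding of `P` with `k` colours:
a set `G` of vertices of `P` together with a colouring `χ` (only its values on
`G` matter) such that every point of `P` sees at least one guard whose colour
is unique among the guards that this point sees. -/
def IsCFGuardV2P (P : SimplePolygon) (G : Finset (ℝ × ℝ)) (k : ℕ)
    (χ : ℝ × ℝ → Fin k) : Prop :=
  ↑G ⊆ Set.range P.vtx ∧
  ∀ p ∈ P.region, ∃ g ∈ G, P.Sees g p ∧
    ∀ h ∈ G, h ≠ g → P.Sees h p → χ h ≠ χ g

/-- A vertex-to-vertex conflict-free chromatic guarding of `P` with `k`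
colours: every vertex of `P` sees at least one guard whose colour is unique
among the guards that this vertex sees. -/
def IsCFGuardV2V (P : SimplePolygon) (G : Finset (ℝ × ℝ)) (k : ℕ)
    (χ : ℝ × ℝ → Fin k) : Prop :=
  ↑G ⊆ Set.range P.vtx ∧
  ∀ i : Fin P.n, ∃ g ∈ G, P.Sees g (P.vtx i) ∧
    ∀ h ∈ G, h ≠ g → P.Sees h (P.vtx i) → χ h ≠ χ g

end SimplePolygon

/-- Piecewise linear interpolation. -/
theorem exists_pl (x y : ℕ → ℝ) (n : ℕ) (hx : ∀ k < n, x k < x (k + 1)) :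
    ∃ L : ℝ → ℝ, Continuous L ∧ L (x n) = y n ∧
      (∀ k < n, ∀ s : ℝ, 0 ≤ s → s ≤ 1 →
        L ((1 - s) * x k + s * x (k + 1)) = (1 - s) * y k + s * y (k + 1)) := by
  induction n with
  | zero => exact ⟨fun _ => y 0, continuous_const, rfl, by simp⟩
  | succ n ih =>
    obtain ⟨L, hc, hn, hk⟩ := ih (fun k hk => hx k (by omega))
    have hlt := hx n (by omega)
    have mono : ∀ m ≤ n, x m ≤ x n := by
      intro m hm
      induction hm using Nat.decreasingInduction with
      | self => exact le_rfl
      | of_succ k hk ih => exact (hx k (by omega)).le.trans ih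
    have hd : x (n + 1) - x n ≠ 0 := by linarith
    refine ⟨fun t => L (min t (x n)) +
      (y (n + 1) - y n) / (x (n + 1) - x n) * (max t (x n) - x n), by fun_prop, ?_, ?_⟩
    · simp only [min_eq_right hlt.le, max_eq_left hlt.le, hn]
      field_simp
      ring
    · intro k hkn s hs0 hs1
      rcases Nat.lt_succ_iff_lt_or_eq.mp hkn with h | rfl
      · have h1 := mono k (by omega)
        have h2 := mono (k + 1) (by omega)
        have h3 : (1 - s) * x k + s * x (k + 1) ≤ x n := by nlinarith
        simp only [min_eq_left h3, max_eq_right h3, hk k h s hs0 hs1]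
        ring
      · have h3 : x k ≤ (1 - s) * x k + s * x (k + 1) := by nlinarith
        simp only [min_eq_right h3, max_eq_left h3, hn]
        field_simp
        ring

/-- Every point of the range lies in one of the pieces. -/
theorem pl_cover (x : ℕ → ℝ) (n : ℕ) (hx : ∀ k < n, x k < x (k + 1)) (hn : 0 < n) (t : ℝ)
    (h0 : x 0 ≤ t) (h1 : t ≤ x n) :
    ∃ k < n, ∃ s : ℝ, 0 ≤ s ∧ s ≤ 1 ∧ t = (1 - s) * x k + s * x (k + 1) := by
  induction n with
  | zero => omega
  | succ n ih =>
    rcases le_or_gt t (x n) with h | h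
    · rcases Nat.eq_zero_or_pos n with rfl | hpos
      · have := hx 0 (by omega)
        exact ⟨0, by omega, 0, le_rfl, zero_le_one, by linarith⟩
      · obtain ⟨k, hk, r⟩ := ih (fun k hk => hx k (by omega)) hpos h
        exact ⟨k, by omega, r⟩
    · have hlt := hx n (by omega)
      have hd : 0 < x (n + 1) - x n := by linarith
      refine ⟨n, by omega, (t - x n) / (x (n + 1) - x n), by apply div_nonneg <;> linarith,
        by rw [div_le_one hd]; linarith, ?_⟩
      field_simp
      ring

/-- An affine function that is nonnegative at both ends is nonnegative in between. -/
theorem affine_nonneg {a b lo hi t : ℝ} (h1 : lo ≤ t) (h2 : t ≤ hi) (h3 : 0 ≤ a + b * lo)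
    (h4 : 0 ≤ a + b * hi) : 0 ≤ a + b * t := by
  rcases le_total 0 b with h | h <;> nlinarith

/-- A piecewise affine function is nonnegative on `[p, q]` as soon as it is at `p`, `q` and at
the break points strictly in between. -/
theorem pl_nonneg (x : ℕ → ℝ) (n : ℕ) (hx : ∀ k < n, x k < x (k + 1)) (hn : 0 < n)
    (f : ℝ → ℝ)
    (hf : ∀ k < n, ∃ a b : ℝ, ∀ t, x k ≤ t → t ≤ x (k + 1) → f t = a + b * t)
    (p q : ℝ) (hp0 : x 0 ≤ p) (hqn : q ≤ x n) (hp : 0 ≤ f p) (hq : 0 ≤ f q)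
    (hv : ∀ k ≤ n, p < x k → x k < q → 0 ≤ f (x k)) (t : ℝ) (hpt : p ≤ t) (htq : t ≤ q) :
    0 ≤ f t := by
  obtain ⟨k, hk, s, hs0, hs1, hs⟩ := pl_cover x n hx hn t (hp0.trans hpt) (htq.trans hqn)
  have hlt := hx k hk
  have k1 : x k ≤ t := by nlinarith
  have k2 : t ≤ x (k + 1) := by nlinarith
  obtain ⟨a, b, hab⟩ := hf k hk
  rw [hab t k1 k2]
  apply affine_nonneg (lo := max p (x k)) (hi := min q (x (k + 1)))
  · exact max_le hpt k1
  · exact le_min htq k2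
  · rcases le_or_gt (x k) p with h | h
    · rw [max_eq_left h, ← hab p h (hpt.trans k2)]; exact hp
    · rw [max_eq_right h.le, ← hab _ le_rfl hlt.le]
      rcases lt_or_ge (x k) q with h' | h'
      · exact hv k hk.le h h'
      · have : x k = q := le_antisymm (k1.trans htq) h'
        rw [this]; exact hq
  · rcases le_or_gt q (x (k + 1)) with h | h
    · rw [min_eq_left h, ← hab q (k1.trans htq) h]; exact hq
    · rw [min_eq_right h.le, ← hab _ hlt.le le_rfl]
      rcases lt_or_ge p (x (k + 1)) with h' | h'
      · exact hv (k + 1) hk h' h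
      · have : x (k + 1) = p := le_antisymm h' (hpt.trans k2)
        rw [this]; exact hp

/-- The region of an `x`-monotone polygon bounded by the graphs of `L` and `U`. -/
theorem region_char (P : SimplePolygon) (L U : ℝ → ℝ) (hL : Continuous L) (hU : Continuous U)
    (x0 x1 : ℝ)
    (h1 : ∀ p ∈ P.boundary, x0 ≤ p.1 ∧ p.1 ≤ x1 ∧ (p.2 = L p.1 ∨ p.2 = U p.1))
    (h2 : ∀ p : ℝ × ℝ, x0 ≤ p.1 → p.1 ≤ x1 → (p.2 = L p.1 ∨ p.2 = U p.1) → p ∈ P.boundary)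
    (hLU : ∀ t, x0 ≤ t → t ≤ x1 → L t ≤ U t) (e0 : L x0 = U x0) (e1 : L x1 = U x1) :
    P.region = {p | x0 ≤ p.1 ∧ p.1 ≤ x1 ∧ L p.1 ≤ p.2 ∧ p.2 ≤ U p.1} := by
  set K : Set (ℝ × ℝ) := {p | x0 ≤ p.1 ∧ p.1 ≤ x1 ∧ L p.1 ≤ p.2 ∧ p.2 ≤ U p.1} with hK
  set I : Set (ℝ × ℝ) := {p | x0 < p.1 ∧ p.1 < x1 ∧ L p.1 < p.2 ∧ p.2 < U p.1} with hI
  have hKc : IsClosed K :=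
    (isClosed_le continuous_const continuous_fst).inter
      ((isClosed_le continuous_fst continuous_const).inter
      ((isClosed_le (hL.comp continuous_fst) continuous_snd).inter
        (isClosed_le continuous_snd (hU.comp continuous_fst))))
  have hIo : IsOpen I :=
    (isOpen_lt continuous_const continuous_fst).inter
      ((isOpen_lt continuous_fst continuous_const).inter
      ((isOpen_lt (hL.comp continuous_fst) continuous_snd).inter
        (isOpen_lt continuous_snd (hU.comp continuous_fst))))
  have hBK : P.boundary ⊆ K := by
    intro p hp
    obtain ⟨a, b, c⟩ := h1 p hp
    have := hLU p.1 a b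
    refine ⟨a, b, ?_⟩
    rcases c with c | c <;> rw [c] <;> simp [this]
  have hIB : ∀ p ∈ K, p ∉ P.boundary → p ∈ I := by
    rintro p ⟨a, b, c, d⟩ hp
    have n1 : p.2 ≠ L p.1 := fun h => hp (h2 p a b (Or.inl h))
    have n2 : p.2 ≠ U p.1 := fun h => hp (h2 p a b (Or.inr h))
    have c' := lt_of_le_of_ne c n1.symm
    have d' := lt_of_le_of_ne d n2
    refine ⟨lt_of_le_of_ne a ?_, lt_of_le_of_ne b ?_, c', d'⟩
    · intro h; rw [← h, e0] at c'; rw [← h] at d'; linarith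
    · intro h; rw [h, e1] at c'; rw [h] at d'; linarith
  have hKb : Bornology.IsBounded K := by
    obtain ⟨m, hm⟩ := (isCompact_Icc (a := x0) (b := x1)).bddBelow_image hL.continuousOn
    obtain ⟨M, hM⟩ := (isCompact_Icc (a := x0) (b := x1)).bddAbove_image hU.continuousOn
    refine ((Metric.isBounded_Icc x0 x1).prod (Metric.isBounded_Icc m M)).subset ?_
    rintro p ⟨a, b, c, d⟩
    exact ⟨⟨a, b⟩, (hm ⟨p.1, ⟨a, b⟩, rfl⟩).trans c, d.trans (hM ⟨p.1, ⟨a, b⟩, rfl⟩)⟩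
  ext p
  constructor
  · rintro (hp | ⟨hp, hb⟩)
    · exact hBK hp
    · by_contra hpK
      have key : (∀ y ≤ p.2, (p.1, y) ∉ P.boundary) ∨ (∀ y ≥ p.2, (p.1, y) ∉ P.boundary) := by
        by_cases hx : x0 ≤ p.1 ∧ p.1 ≤ x1
        · have hlu := hLU p.1 hx.1 hx.2
          rcases lt_or_ge p.2 (L p.1) with h | h
          · left
            intro y hy hyB
            obtain ⟨-, -, c⟩ := h1 _ hyB
            simp only at c
            rcases c with c | c <;> linarith
          · have h' : U p.1 < p.2 := by
              by_contra h'
              exact hpK ⟨hx.1, hx.2, h, not_lt.mp h'⟩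
            right
            intro y hy hyB
            obtain ⟨-, -, c⟩ := h1 _ hyB
            simp only at c
            rcases c with c | c <;> linarith
        · left
          intro y _ hyB
          obtain ⟨a, b, -⟩ := h1 _ hyB
          exact hx ⟨a, b⟩
      rcases key with h | h
      · have hpre : IsPreconnected ((fun y => (p.1, y)) '' Set.Iic p.2) :=
          isPreconnected_Iic.image _ (by fun_prop)
        have hsub := hpre.subset_connectedComponentIn (F := P.boundaryᶜ) (x := p)
          ⟨p.2, le_refl p.2, rfl⟩ (by rintro _ ⟨y, hy, rfl⟩; exact h y hy)
        have hb2 := ((hb.subset hsub).image_snd)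
        rw [Set.image_image] at hb2
        simp only [Set.image_id'] at hb2
        exact not_bddBelow_Iic _ hb2.bddBelow
      · have hpre : IsPreconnected ((fun y => (p.1, y)) '' Set.Ici p.2) :=
          isPreconnected_Ici.image _ (by fun_prop)
        have hsub := hpre.subset_connectedComponentIn (F := P.boundaryᶜ) (x := p)
          ⟨p.2, le_refl p.2, rfl⟩ (by rintro _ ⟨y, hy, rfl⟩; exact h y hy)
        have hb2 := ((hb.subset hsub).image_snd)
        rw [Set.image_image] at hb2
        simp only [Set.image_id'] at hb2
        exact not_bddAbove_Ici _ hb2.bddAbove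
  · intro hp
    by_cases hpB : p ∈ P.boundary
    · exact Or.inl hpB
    · refine Or.inr ⟨hpB, hKb.subset ?_⟩
      have hIK : I ⊆ K := fun q hq => ⟨hq.1.le, hq.2.1.le, hq.2.2.1.le, hq.2.2.2.le⟩
      refine Set.Subset.trans ?_ hIK
      apply IsPreconnected.subset_left_of_subset_union hIo hKc.isOpen_compl
      · rw [Set.disjoint_compl_right_iff_subset]; exact hIK
      · intro q hq
        have hqB := connectedComponentIn_subset _ _ hq
        by_cases hqK : q ∈ K
        · exact Or.inl (hIB q hqK hqB)
        · exact Or.inr hqK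
      · exact ⟨p, mem_connectedComponentIn hpB, hIB p hp hpB⟩
      · exact isPreconnected_connectedComponentIn
/-- The vertices of the polygon, counterclockwise; the first 19 form the lower chain. -/
def pts : List (ℤ × ℤ) :=
  [(-6000, 850), (-3090, -500), (-3086, -620), (-3073, -560), (-3056, -620), (-3033, -560),
   (-3026, -620), (-3010, -500), (-2990, -500), (-2974, -620), (-2967, -560), (-2944, -620),
   (-2927, -560), (-2914, -620), (-2910, -500), (0, 0), (1500, -400), (3000, 0), (6000, -125),
   (3090, 1000), (3086, 1120), (3073, 1060), (3056, 1120), (3033, 1060), (3026, 1120),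
   (3010, 1000), (2990, 1000), (2974, 1120), (2967, 1060), (2944, 1120), (2927, 1060),
   (2914, 1120), (2910, 1000), (90, 1000), (86, 1120), (73, 1060), (56, 1120), (33, 1060),
   (26, 1120), (10, 1000), (-10, 1000), (-26, 1120), (-33, 1060), (-56, 1120), (-73, 1060),
   (-86, 1120), (-90, 1000), (-3000, 500)]

/-- The lower chain, from left to right. -/
def lowL : List (ℤ × ℤ) := pts.take 19

/-- The vertices on the upper chain. -/
def upL : List (ℤ × ℤ) := (-6000, 850) :: pts.drop 18

/-- The vertex with a given number. -/
def pt (k : ℕ) : ℤ × ℤ := pts.getD k (0, 0)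

/-- The upper chain, from left to right. -/
def upt (k : ℕ) : ℤ × ℤ := pt ((48 - k) % 48)

/-- Orientation determinant. -/
def cr (p q r : ℤ × ℤ) : ℤ := (q.1 - p.1) * (r.2 - p.2) - (q.2 - p.2) * (r.1 - p.1)

/-- Embedding of integer points in the plane. -/
def emb (p : ℤ × ℤ) : ℝ × ℝ := ((p.1 : ℝ), (p.2 : ℝ))

theorem emb_inj : Function.Injective emb := by
  rintro ⟨a, b⟩ ⟨c, d⟩ h
  simpa [emb] using h

theorem mem_seg {p a b : ℝ × ℝ} (h : p ∈ segment ℝ a b) :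
    ∃ s : ℝ, 0 ≤ s ∧ s ≤ 1 ∧ p.1 = (1 - s) * a.1 + s * b.1 ∧ p.2 = (1 - s) * a.2 + s * b.2 := by
  obtain ⟨u, v, hu, hv, huv, rfl⟩ := h
  have hu' : u = 1 - v := by linarith
  subst hu'
  exact ⟨v, hv, by linarith, by simp, by simp⟩

theorem mem_seg' {p a b : ℝ × ℝ} {s : ℝ} (h0 : 0 ≤ s) (h1 : s ≤ 1)
    (hx : p.1 = (1 - s) * a.1 + s * b.1) (hy : p.2 = (1 - s) * a.2 + s * b.2) :
    p ∈ segment ℝ a b :=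
  ⟨1 - s, s, by linarith, h0, by ring, by ext <;> simp [hx, hy]⟩

/-- The test for disjointness of two segments. -/
def disjB (a b c d : ℤ × ℤ) : Bool :=
  (decide (0 < cr a b c) && decide (0 < cr a b d)) ||
  (decide (cr a b c < 0) && decide (cr a b d < 0)) ||
  (decide (0 < cr c d a) && decide (0 < cr c d b)) ||
  (decide (cr c d a < 0) && decide (cr c d b < 0)) ||
  (decide (max a.1 b.1 < min c.1 d.1)) || (decide (max c.1 d.1 < min a.1 b.1))

/-- If `c`, `d` are on the positive side (up to the sign `e`) of the line through `a`, `b`, no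
point of `[c, d]` is on that line. -/
theorem side_aux {a b c d : ℝ × ℝ} {s t e : ℝ} (ht0 : 0 ≤ t) (ht1 : t ≤ 1)
    (hx : (1 - s) * a.1 + s * b.1 = (1 - t) * c.1 + t * d.1)
    (hy : (1 - s) * a.2 + s * b.2 = (1 - t) * c.2 + t * d.2)
    (hc : 0 < e * ((b.1 - a.1) * (c.2 - a.2) - (b.2 - a.2) * (c.1 - a.1)))
    (hd : 0 < e * ((b.1 - a.1) * (d.2 - a.2) - (b.2 - a.2) * (d.1 - a.1))) : False := by
  have key : (1 - t) * (e * ((b.1 - a.1) * (c.2 - a.2) - (b.2 - a.2) * (c.1 - a.1))) +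
      t * (e * ((b.1 - a.1) * (d.2 - a.2) - (b.2 - a.2) * (d.1 - a.1))) = 0 := by
    linear_combination (-e * (b.1 - a.1)) * hy + e * (b.2 - a.2) * hx
  rcases lt_or_ge t 1 with h | h
  · have := mul_pos (sub_pos.mpr h) hc
    have := mul_nonneg ht0 hd.le
    linarith
  · have : t = 1 := le_antisymm ht1 h
    subst this
    linarith

theorem cast_lt {a b : ℤ} (h : a < b) : (a : ℝ) < (b : ℝ) := by exact_mod_cast h

theorem cast_le {a b : ℤ} (h : a ≤ b) : (a : ℝ) ≤ (b : ℝ) := by exact_mod_cast h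

theorem disjB_sound {a b c d : ℤ × ℤ} (h : disjB a b c d = true) :
    segment ℝ (emb a) (emb b) ∩ segment ℝ (emb c) (emb d) = ∅ := by
  rw [Set.eq_empty_iff_forall_notMem]
  rintro p ⟨h1, h2⟩
  obtain ⟨s, hs0, hs1, hsx, hsy⟩ := mem_seg h1
  obtain ⟨t, ht0, ht1, htx, hty⟩ := mem_seg h2
  have hx := hsx.symm.trans htx
  have hy := hsy.symm.trans hty
  simp only [disjB, Bool.or_eq_true, Bool.and_eq_true, decide_eq_true_eq] at h
  unfold cr at h
  rcases h with ((((⟨h, h'⟩ | ⟨h, h'⟩) | ⟨h, h'⟩) | ⟨h, h'⟩) | h) | h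
  · have := cast_lt h; have := cast_lt h'; push_cast at *
    refine side_aux (e := 1) ht0 ht1 hx hy ?_ ?_ <;> simp only [emb] <;> linarith
  · have := cast_lt h; have := cast_lt h'; push_cast at *
    refine side_aux (e := -1) ht0 ht1 hx hy ?_ ?_ <;> simp only [emb] <;> linarith
  · have := cast_lt h; have := cast_lt h'; push_cast at *
    refine side_aux (e := 1) hs0 hs1 hx.symm hy.symm ?_ ?_ <;> simp only [emb] <;> linarith
  · have := cast_lt h; have := cast_lt h'; push_cast at *
    refine side_aux (e := -1) hs0 hs1 hx.symm hy.symm ?_ ?_ <;> simp only [emb] <;> linarith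
  · simp only [max_lt_iff, lt_min_iff] at h
    obtain ⟨⟨u1, u2⟩, u3, u4⟩ := h
    have u1 := cast_lt u1; have u2 := cast_lt u2; have u3 := cast_lt u3; have u4 := cast_lt u4
    simp only [emb] at hx
    have e1 : (1 - s) * (a.1 : ℝ) + s * b.1 ≤ max (a.1 : ℝ) b.1 := by
      nlinarith [le_max_left (a.1 : ℝ) b.1, le_max_right (a.1 : ℝ) b.1]
    have e2 : min (c.1 : ℝ) d.1 ≤ (1 - t) * (c.1 : ℝ) + t * d.1 := by
      nlinarith [min_le_left (c.1 : ℝ) d.1, min_le_right (c.1 : ℝ) d.1]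
    have e3 : max (a.1 : ℝ) b.1 < min (c.1 : ℝ) d.1 := by
      simp only [max_lt_iff, lt_min_iff]; exact ⟨⟨u1, u2⟩, u3, u4⟩
    linarith
  · simp only [max_lt_iff, lt_min_iff] at h
    obtain ⟨⟨u1, u2⟩, u3, u4⟩ := h
    have u1 := cast_lt u1; have u2 := cast_lt u2; have u3 := cast_lt u3; have u4 := cast_lt u4
    simp only [emb] at hx
    have e1 : (1 - t) * (c.1 : ℝ) + t * d.1 ≤ max (c.1 : ℝ) d.1 := by
      nlinarith [le_max_left (c.1 : ℝ) d.1, le_max_right (c.1 : ℝ) d.1]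
    have e2 : min (a.1 : ℝ) b.1 ≤ (1 - s) * (a.1 : ℝ) + s * b.1 := by
      nlinarith [min_le_left (a.1 : ℝ) b.1, min_le_right (a.1 : ℝ) b.1]
    have e3 : max (c.1 : ℝ) d.1 < min (a.1 : ℝ) b.1 := by
      simp only [max_lt_iff, lt_min_iff]; exact ⟨⟨u1, u2⟩, u3, u4⟩
    linarith

theorem consec_sound {a b c : ℤ × ℤ} (h : cr a b c ≠ 0) :
    segment ℝ (emb a) (emb b) ∩ segment ℝ (emb b) (emb c) = {emb b} := by
  apply Set.Subset.antisymm
  · rintro p ⟨h1, h2⟩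
    obtain ⟨s, hs0, hs1, hsx, hsy⟩ := mem_seg h1
    obtain ⟨t, ht0, ht1, htx, hty⟩ := mem_seg h2
    have hne : ((b.1 : ℝ) - a.1) * (c.2 - a.2) - (b.2 - a.2) * (c.1 - a.1) ≠ 0 := by
      exact_mod_cast h
    simp only [emb] at *
    have ht : t = 0 := by
      have : t * (((b.1 : ℝ) - a.1) * (c.2 - a.2) - (b.2 - a.2) * (c.1 - a.1)) = 0 := by
        linear_combination ((b.2 : ℝ) - a.2) * (htx - hsx) - ((b.1 : ℝ) - a.1) * (hty - hsy)
      exact (mul_eq_zero.mp this).resolve_right hne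
    subst ht
    ext
    · simpa using htx
    · simpa using hty
  · rintro p rfl
    exact ⟨right_mem_segment _ _ _, left_mem_segment _ _ _⟩

/-- The polygon. -/
def poly : SimplePolygon where
  n := 48
  three_le := by norm_num
  vtx i := emb (pt i.1)
  inj := by
    intro i j h
    have h := emb_inj h
    have key : ∀ i j : Fin 48, pt i.1 = pt j.1 → i = j := by decide +kernel
    exact key i j h
  consec_edges := by
    have : ∀ i : Fin 48, cr (pt i.1) (pt (i + 1).1) (pt (i + 1 + 1).1) ≠ 0 := by decide +kernel
    exact fun i => consec_sound (this i)
  nonconsec_edges := by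
    have : ∀ i j : Fin 48, i ≠ j → j ≠ i + 1 → i ≠ j + 1 →
        disjB (pt i.1) (pt (i + 1).1) (pt j.1) (pt (j + 1).1) = true := by decide +kernel
    exact fun i j h1 h2 h3 => disjB_sound (this i j h1 h2 h3)


theorem poly_boundary : poly.boundary =
    ⋃ i : Fin 48, segment ℝ (emb (pt i.1)) (emb (pt ((i.1 + 1) % 48))) := by
  have key : ∀ i : Fin 48, (i + 1).1 = (i.1 + 1) % 48 := by decide
  have : ∀ i : Fin 48, segment ℝ (emb (pt i.1)) (emb (pt ((i.1 + 1) % 48))) =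
      segment ℝ (emb (pt i.1)) (emb (pt (i + 1).1)) := fun i => by rw [key i]
  simp_rw [this]
  rfl

/-- The test that the lower edge `ab` is below the upper edge `cd`. -/
def luB (a b c d : ℤ × ℤ) : Bool :=
  (decide (0 ≤ cr a b c) && decide (0 ≤ cr a b d)) ||
  (decide (cr c d a ≤ 0) && decide (cr c d b ≤ 0)) ||
  (decide (b.1 < c.1)) || (decide (d.1 < a.1))

theorem luB_sound {a b c d : ℤ × ℤ} (h : luB a b c d = true) (hab : a.1 < b.1) (hcd : c.1 < d.1)
    {s t : ℝ} (hs0 : 0 ≤ s) (hs1 : s ≤ 1) (ht0 : 0 ≤ t) (ht1 : t ≤ 1)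
    (hx : (1 - s) * (a.1 : ℝ) + s * b.1 = (1 - t) * (c.1 : ℝ) + t * d.1) :
    (1 - s) * (a.2 : ℝ) + s * b.2 ≤ (1 - t) * (c.2 : ℝ) + t * d.2 := by
  have hab := cast_lt hab
  have hcd := cast_lt hcd
  simp only [luB, Bool.or_eq_true, Bool.and_eq_true, decide_eq_true_eq] at h
  unfold cr at h
  rcases h with ((⟨h, h'⟩ | ⟨h, h'⟩) | h) | h
  · have h := cast_le h
    have h' := cast_le h'
    push_cast at h h'
    have h3 := add_nonneg (mul_nonneg (sub_nonneg.mpr ht1) h) (mul_nonneg ht0 h')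
    have h4 : 0 ≤ ((b.1 : ℝ) - a.1) *
        ((1 - t) * (c.2 : ℝ) + t * d.2 - ((1 - s) * (a.2 : ℝ) + s * b.2)) := by
      refine h3.trans (le_of_eq ?_)
      linear_combination ((b.2 : ℝ) - a.2) * hx
    have := nonneg_of_mul_nonneg_right h4 (by linarith)
    linarith
  · have h := cast_le h
    have h' := cast_le h'
    push_cast at h h'
    have h3 := add_nonneg (mul_nonneg (sub_nonneg.mpr hs1) (neg_nonneg.mpr h))
      (mul_nonneg hs0 (neg_nonneg.mpr h'))
    have h4 : 0 ≤ ((d.1 : ℝ) - c.1) *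
        ((1 - t) * (c.2 : ℝ) + t * d.2 - ((1 - s) * (a.2 : ℝ) + s * b.2)) := by
      refine h3.trans (le_of_eq ?_)
      linear_combination ((d.2 : ℝ) - c.2) * hx
    have := nonneg_of_mul_nonneg_right h4 (by linarith)
    linarith
  · have h := cast_lt h
    exfalso
    nlinarith
  · have h := cast_lt h
    exfalso
    nlinarith

theorem low_lt : ∀ k < 18, (pt k).1 < (pt (k + 1)).1 := by decide +kernel

theorem up_lt : ∀ k < 30, (upt k).1 < (upt (k + 1)).1 := by decide +kernel

theorem lu_all : ∀ k < 18, ∀ j < 30, luB (pt k) (pt (k + 1)) (upt j) (upt (j + 1)) = true := by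
  decide +kernel

theorem low_ltR : ∀ k < 18, ((pt k).1 : ℝ) < ((pt (k + 1)).1 : ℝ) :=
  fun k hk => cast_lt (low_lt k hk)

theorem up_ltR : ∀ k < 30, ((upt k).1 : ℝ) < ((upt (k + 1)).1 : ℝ) :=
  fun k hk => cast_lt (up_lt k hk)

/-- `L` interpolates the chain `q 0, ..., q n`. -/
def Interp (q : ℕ → ℤ × ℤ) (n : ℕ) (L : ℝ → ℝ) : Prop :=
  ∀ k < n, ∀ s : ℝ, 0 ≤ s → s ≤ 1 →
    L ((1 - s) * ((q k).1 : ℝ) + s * ((q (k + 1)).1 : ℝ)) =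
      (1 - s) * ((q k).2 : ℝ) + s * ((q (k + 1)).2 : ℝ)

theorem Interp.at {q : ℕ → ℤ × ℤ} {n : ℕ} {L : ℝ → ℝ} (h : Interp q n L) (hn : 0 < n) {k : ℕ}
    (hk : k ≤ n) : L ((q k).1 : ℝ) = ((q k).2 : ℝ) := by
  rcases hk.lt_or_eq with h1 | rfl
  · simpa using h k h1 0 le_rfl zero_le_one
  · obtain ⟨m, rfl⟩ : ∃ m, k = m + 1 := ⟨k - 1, by omega⟩
    simpa using h m (by omega) 1 zero_le_one le_rfl

theorem Interp.affine {q : ℕ → ℤ × ℤ} {n : ℕ} {L : ℝ → ℝ} (h : Interp q n L)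
    (hq : ∀ k < n, ((q k).1 : ℝ) < ((q (k + 1)).1 : ℝ)) :
    ∀ k < n, ∃ a b : ℝ, ∀ t, ((q k).1 : ℝ) ≤ t → t ≤ ((q (k + 1)).1 : ℝ) → L t = a + b * t := by
  intro k hk
  have hlt := hq k hk
  set x := ((q k).1 : ℝ)
  set x' := ((q (k + 1)).1 : ℝ)
  set y := ((q k).2 : ℝ)
  set y' := ((q (k + 1)).2 : ℝ)
  have hd : 0 < x' - x := by linarith
  refine ⟨y - (y' - y) / (x' - x) * x, (y' - y) / (x' - x), fun t h1 h2 => ?_⟩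
  have e := h k hk ((t - x) / (x' - x)) (by apply div_nonneg <;> linarith)
    (by rw [div_le_one hd]; linarith)
  have e2 : (1 - (t - x) / (x' - x)) * x + (t - x) / (x' - x) * x' = t := by
    field_simp
    ring
  change L ((1 - (t - x) / (x' - x)) * x + (t - x) / (x' - x) * x') =
    (1 - (t - x) / (x' - x)) * y + (t - x) / (x' - x) * y' at e
  rw [e2] at e
  rw [e]
  field_simp
  ring

theorem poly_region : ∃ L U : ℝ → ℝ, Interp pt 18 L ∧ Interp upt 30 U ∧
    poly.region = {p | -6000 ≤ p.1 ∧ p.1 ≤ 6000 ∧ L p.1 ≤ p.2 ∧ p.2 ≤ U p.1} := by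
  obtain ⟨L, hLc, -, hL⟩ := exists_pl (fun k => ((pt k).1 : ℝ)) (fun k => ((pt k).2 : ℝ)) 18 low_ltR
  obtain ⟨U, hUc, -, hU⟩ := exists_pl (fun k => ((upt k).1 : ℝ)) (fun k => ((upt k).2 : ℝ)) 30 up_ltR
  have hL : Interp pt 18 L := hL
  have hU : Interp upt 30 U := hU
  have l0 : pt 0 = (-6000, 850) := by decide
  have l1 : pt 18 = (6000, -125) := by decide
  have u0 : upt 0 = (-6000, 850) := by decide
  have u1 : upt 30 = (6000, -125) := by decide
  have lcov := pl_cover (fun k => ((pt k).1 : ℝ)) 18 low_ltR (by norm_num)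
  have ucov := pl_cover (fun k => ((upt k).1 : ℝ)) 30 up_ltR (by norm_num)
  simp only [l0, l1, u0, u1] at lcov ucov
  push_cast at lcov ucov
  have hxb : ∀ k : Fin 48, -6000 ≤ (pt k.1).1 ∧ (pt k.1).1 ≤ 6000 := by decide +kernel
  refine ⟨L, U, hL, hU, region_char poly L U hLc hUc _ _ ?_ ?_ ?_ ?_ ?_⟩
  · intro p hp
    rw [poly_boundary, Set.mem_iUnion] at hp
    obtain ⟨i, hi⟩ := hp
    obtain ⟨s, hs0, hs1, hx, hy⟩ := mem_seg hi
    have b1 := hxb i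
    have b2 := hxb ⟨(i.1 + 1) % 48, Nat.mod_lt _ (by norm_num)⟩
    have c1 := cast_le b1.1
    have c2 := cast_le b1.2
    have c3 := cast_le b2.1
    have c4 := cast_le b2.2
    simp only [emb] at hx hy
    push_cast at c1 c2 c3 c4
    refine ⟨by rw [hx]; nlinarith, by rw [hx]; nlinarith, ?_⟩
    rcases lt_or_ge i.1 18 with h | h
    · left
      rw [Nat.mod_eq_of_lt (by omega)] at hx hy
      rw [hx, hy]
      exact (hL i.1 h s hs0 hs1).symm
    · right
      have hi := i.2
      have e1 : pt i.1 = upt (47 - i.1 + 1) := by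
        unfold upt; congr 1; omega
      have e2 : pt ((i.1 + 1) % 48) = upt (47 - i.1) := by
        unfold upt; congr 1; omega
      rw [e1, e2] at hx hy
      have := hU (47 - i.1) (by omega) (1 - s) (by linarith) (by linarith)
      rw [hx, hy, add_comm ((1 - s) * _), add_comm ((1 - s) * _)]
      rw [sub_sub_cancel] at this
      exact this.symm
  · intro p h0 h1 h
    rw [poly_boundary, Set.mem_iUnion]
    rcases h with h | h
    · obtain ⟨k, hk, s, hs0, hs1, hs⟩ := lcov p.1 h0 h1
      refine ⟨⟨k, by omega⟩, ?_⟩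
      simp only [Nat.mod_eq_of_lt (show k + 1 < 48 by omega)]
      refine mem_seg' hs0 hs1 hs ?_
      rw [h, hs]
      exact hL k hk s hs0 hs1
    · obtain ⟨k, hk, s, hs0, hs1, hs⟩ := ucov p.1 h0 h1
      refine ⟨⟨47 - k, by omega⟩, ?_⟩
      have e1 : pt (47 - k) = upt (k + 1) := by
        unfold upt; congr 1; omega
      have e2 : pt ((47 - k + 1) % 48) = upt k := by
        unfold upt; congr 1; omega
      simp only [e1, e2]
      rw [segment_symm]
      refine mem_seg' hs0 hs1 hs ?_
      rw [h, hs]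
      exact hU k hk s hs0 hs1
  · intro t h0 h1
    obtain ⟨k, hk, s, hs0, hs1, hs⟩ := lcov t h0 h1
    obtain ⟨j, hj, r, hr0, hr1, hr⟩ := ucov t h0 h1
    have := luB_sound (lu_all k hk j hj) (low_lt k hk) (up_lt j hj) hs0 hs1 hr0 hr1
      (hs.symm.trans hr)
    rw [← hL k hk s hs0 hs1, ← hU j hj r hr0 hr1] at this
    rw [hs] at *
    rwa [← hr] at this
  · have a := hL.at (by norm_num) (Nat.zero_le _)
    have b := hU.at (by norm_num) (Nat.zero_le _)
    rw [l0] at a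
    rw [u0] at b
    push_cast at a b
    rw [a, b]
  · have a := hL.at (by norm_num) le_rfl
    have b := hU.at (by norm_num) le_rfl
    rw [l1] at a
    rw [u1] at b
    push_cast at a b
    rw [a, b]

/-- Visibility test for the segment from `p` to `q`, where `p` is to the left of `q`. -/
def seesL (p q : ℤ × ℤ) : Bool :=
  (lowL.all fun v => decide (v.1 ≤ p.1) || decide (q.1 ≤ v.1) || decide (cr p q v ≤ 0)) &&
  (upL.all fun v => decide (v.1 ≤ p.1) || decide (q.1 ≤ v.1) || decide (0 ≤ cr p q v))

/-- Visibility test. -/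
def seesB (p q : ℤ × ℤ) : Bool :=
  if p.1 < q.1 then seesL p q else if q.1 < p.1 then seesL q p else true

theorem low_mem : ∀ k ≤ 18, pt k ∈ lowL := by decide +kernel

theorem up_mem : ∀ k ≤ 30, upt k ∈ upL := by decide +kernel

theorem low_mem' : ∀ v ∈ lowL, ∃ k ≤ 18, v = pt k := by decide +kernel

theorem up_mem' : ∀ v ∈ upL, ∃ k ≤ 30, v = upt k := by decide +kernel

theorem vtx_region (i : Fin 48) : emb (pt i.1) ∈ poly.region := by
  left
  rw [poly_boundary, Set.mem_iUnion]
  exact ⟨i, left_mem_segment _ _ _⟩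

theorem seesL_sound (i j : Fin 48) (hij : (pt i.1).1 < (pt j.1).1) :
    poly.Sees (emb (pt i.1)) (emb (pt j.1)) ↔ seesL (pt i.1) (pt j.1) = true := by
  obtain ⟨L, U, hL, hU, hR⟩ := poly_region
  have l0 : pt 0 = (-6000, 850) := by decide
  have l1 : pt 18 = (6000, -125) := by decide
  have u0 : upt 0 = (-6000, 850) := by decide
  have u1 : upt 30 = (6000, -125) := by decide
  have hi := vtx_region i
  have hj := vtx_region j
  generalize pt i.1 = p at *
  generalize pt j.1 = q at *
  have hlt := cast_lt hij
  have hd : 0 < (q.1 : ℝ) - p.1 := by linarith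
  rw [hR] at hi hj
  obtain ⟨i1, i2, i3, i4⟩ := hi
  obtain ⟨j1, j2, j3, j4⟩ := hj
  simp only [emb] at i1 i2 i3 i4 j1 j2 j3 j4
  -- the height of the segment over `t`
  obtain ⟨S, hS⟩ : ∃ S : ℝ → ℝ,
      ∀ t, S t = p.2 + ((q.2 : ℝ) - p.2) / (q.1 - p.1) * (t - p.1) := ⟨_, fun _ => rfl⟩
  have hSp : S p.1 = p.2 := by rw [hS]; ring
  have hSq : S q.1 = q.2 := by rw [hS]; field_simp; ring
  have hcr : ∀ v : ℤ × ℤ, ((cr p q v : ℤ) : ℝ) = (q.1 - p.1) * ((v.2 : ℝ) - S v.1) := by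
    intro v
    rw [hS]
    unfold cr
    push_cast
    field_simp
    ring
  have hseg : ∀ t : ℝ, (p.1 : ℝ) ≤ t → t ≤ q.1 → (t, S t) ∈ segment ℝ (emb p) (emb q) := by
    intro t h1 h2
    refine mem_seg' (s := (t - p.1) / (q.1 - p.1)) (by apply div_nonneg <;> linarith)
      (by rw [div_le_one hd]; linarith) ?_ ?_
    · simp only [emb]; field_simp; ring
    · simp only [emb, hS]; field_simp; ring
  simp only [seesL, Bool.and_eq_true, List.all_eq_true, Bool.or_eq_true, decide_eq_true_eq]
  constructor
  · intro h
    constructor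
    · intro v hv
      by_contra! hc
      obtain ⟨⟨c1, c2⟩, c3⟩ := hc
      have c1 := cast_lt c1
      have c2 := cast_lt c2
      have c3 := cast_lt c3
      rw [hcr, Int.cast_zero] at c3
      have c4 := pos_of_mul_pos_right c3 hd.le
      have := h (hseg v.1 c1.le c2.le)
      rw [hR] at this
      obtain ⟨-, -, h3, -⟩ := this
      obtain ⟨k, hk, rfl⟩ := low_mem' v hv
      simp only at h3
      rw [hL.at (by norm_num) hk] at h3
      linarith
    · intro v hv
      by_contra! hc
      obtain ⟨⟨c1, c2⟩, c3⟩ := hc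
      have c1 := cast_lt c1
      have c2 := cast_lt c2
      have c3 := cast_lt c3
      rw [hcr, Int.cast_zero] at c3
      have c4 : (v.2 : ℝ) - S v.1 < 0 := by
        by_contra hc
        have := mul_nonneg hd.le (not_lt.mp hc)
        linarith
      have := h (hseg v.1 c1.le c2.le)
      rw [hR] at this
      obtain ⟨-, -, -, h3⟩ := this
      obtain ⟨k, hk, rfl⟩ := up_mem' v hv
      simp only at h3
      rw [hU.at (by norm_num) hk] at h3
      linarith
  · rintro ⟨hlow, hup⟩ w hw
    obtain ⟨s, hs0, hs1, hx, hy⟩ := mem_seg hw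
    simp only [emb] at hx hy
    have w1 : (p.1 : ℝ) ≤ w.1 := by rw [hx]; nlinarith
    have w2 : w.1 ≤ q.1 := by rw [hx]; nlinarith
    have w3 : w.2 = S w.1 := by
      rw [hS, hx, hy]; field_simp; ring
    rw [hR]
    refine ⟨i1.trans w1, w2.trans j2, ?_, ?_⟩
    · have := pl_nonneg (fun k => ((pt k).1 : ℝ)) 18 low_ltR (by norm_num) (fun t => S t - L t)
        (by
          intro k hk
          obtain ⟨a, b, hab⟩ := hL.affine low_ltR k hk
          refine ⟨p.2 - ((q.2 : ℝ) - p.2) / (q.1 - p.1) * p.1 - a,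
            ((q.2 : ℝ) - p.2) / (q.1 - p.1) - b, fun t h1 h2 => ?_⟩
          simp only [hab t h1 h2, hS]
          ring)
        p.1 q.1 (by simp only [l0]; push_cast; exact i1) (by simp only [l1]; push_cast; exact j2)
        (by simp only [hSp]; linarith) (by simp only [hSq]; linarith)
        (by
          intro k hk h1 h2
          simp only [hL.at (by norm_num) hk]
          rcases hlow _ (low_mem k hk) with (c | c) | c
          · have := cast_le c; linarith
          · have := cast_le c; linarith
          · have c := cast_le c
            rw [hcr, Int.cast_zero] at c
            by_contra hc
            have := mul_pos hd (show 0 < ((pt k).2 : ℝ) - S (pt k).1 by linarith)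
            linarith)
        w.1 w1 w2
      linarith
    · have := pl_nonneg (fun k => ((upt k).1 : ℝ)) 30 up_ltR (by norm_num) (fun t => U t - S t)
        (by
          intro k hk
          obtain ⟨a, b, hab⟩ := hU.affine up_ltR k hk
          refine ⟨a - (p.2 - ((q.2 : ℝ) - p.2) / (q.1 - p.1) * p.1),
            b - ((q.2 : ℝ) - p.2) / (q.1 - p.1), fun t h1 h2 => ?_⟩
          simp only [hab t h1 h2, hS]
          ring)
        p.1 q.1 (by simp only [u0]; push_cast; exact i1) (by simp only [u1]; push_cast; exact j2)
        (by simp only [hSp]; linarith) (by simp only [hSq]; linarith)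
        (by
          intro k hk h1 h2
          simp only [hU.at (by norm_num) hk]
          rcases hup _ (up_mem k hk) with (c | c) | c
          · have := cast_le c; linarith
          · have := cast_le c; linarith
          · have c := cast_le c
            rw [hcr, Int.cast_zero] at c
            by_contra hc
            have := mul_pos hd (show 0 < S (upt k).1 - ((upt k).2 : ℝ) by linarith)
            linarith)
        w.1 w1 w2
      linarith

theorem sees_iff (i j : Fin 48) :
    poly.Sees (emb (pt i.1)) (emb (pt j.1)) ↔ seesB (pt i.1) (pt j.1) = true := by
  unfold seesB
  split_ifs with h1 h2
  · exact seesL_sound i j h1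
  · rw [← seesL_sound j i h2]
    unfold SimplePolygon.Sees
    rw [segment_symm]
  · have key : ∀ i j : Fin 48, ¬ (pt i.1).1 < (pt j.1).1 → ¬ (pt j.1).1 < (pt i.1).1 → i = j := by
      decide +kernel
    have := key i j h1 h2
    subst this
    simp only [iff_true, SimplePolygon.Sees, segment_same, Set.singleton_subset_iff]
    exact vtx_region i

/-- The visibility relation between the vertices. -/
def adj (i j : Fin 48) : Prop := seesB (pt i.1) (pt j.1) = true

instance (i j : Fin 48) : Decidable (adj i j) := inferInstanceAs (Decidable (_ = true))

theorem seesB_comm (p q : ℤ × ℤ) : seesB p q = seesB q p := by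
  unfold seesB
  split_ifs with h1 h2
  · omega
  all_goals rfl

theorem adj_symm (i j : Fin 48) (h : adj i j) : adj j i := by
  unfold adj at *
  rwa [seesB_comm]

/-- Colour `c` occurs exactly once among the guards seen from `i`. -/
def Uniq (col : Fin 48 → Option (Fin 2)) (c : Fin 2) (i : Fin 48) : Prop :=
  ∃ j, adj i j ∧ col j = some c ∧ ∀ k, adj i k → col k = some c → k = j

/-- The hub `h` sees all of the pocket `p`, whose inner vertices see nothing else but `h`. -/
def IsPocket (h : Fin 48) (p : Fin 7 → Fin 48) : Prop :=
  (∀ j, adj h (p j)) ∧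
  (∀ k, adj (p 1) k ↔ k = h ∨ k = p 0 ∨ k = p 1 ∨ k = p 2) ∧
  (∀ k, adj (p 2) k ↔ k = h ∨ k = p 0 ∨ k = p 1 ∨ k = p 2 ∨ k = p 3 ∨ k = p 4 ∨ k = p 6) ∧
  (∀ k, adj (p 3) k ↔ k = h ∨ k = p 0 ∨ k = p 2 ∨ k = p 3 ∨ k = p 4 ∨ k = p 6) ∧
  (∀ k, adj (p 4) k ↔ k = h ∨ k = p 0 ∨ k = p 2 ∨ k = p 3 ∨ k = p 4 ∨ k = p 5 ∨ k = p 6) ∧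
  (∀ k, adj (p 5) k ↔ k = h ∨ k = p 4 ∨ k = p 5 ∨ k = p 6) ∧
  (∀ i j, p i = p j → i = j)

instance (h : Fin 48) (p : Fin 7 → Fin 48) : Decidable (IsPocket h p) := by
  unfold IsPocket
  infer_instance

/-- A pocket cannot be guarded with one colour from inside. -/
theorem pocket_false {col : Fin 48 → Option (Fin 2)} {h : Fin 48} {p : Fin 7 → Fin 48}
    (hp : IsPocket h p) (hcol : ∀ i, ∃ c, Uniq col c i) (hh : col h = none) (c : Fin 2)
    (hc : ∀ j, col (p j) ≠ some c) : False := by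
  obtain ⟨-, q1, q2, q3, q4, q5, inj⟩ := hp
  obtain ⟨d, hd⟩ : ∃ d : Fin 2, ∀ e, e ≠ c → e = d := by
    have key : ∀ c : Fin 2, ∃ d : Fin 2, ∀ e, e ≠ c → e = d := by decide
    exact key c
  have hU : ∀ i, (∀ k, adj i k → k = h ∨ ∃ j, k = p j) → Uniq col d i := by
    intro i hi
    obtain ⟨e, j, h1, h2, h3⟩ := hcol i
    have : e = d := by
      apply hd
      rintro rfl
      rcases hi j h1 with rfl | ⟨m, rfl⟩
      · rw [hh] at h2; cases h2
      · exact hc m h2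
    subst this
    exact ⟨j, h1, h2, h3⟩
  have v1 := hU (p 1) (by intro k hk; rw [q1] at hk; grind)
  have v2 := hU (p 2) (by intro k hk; rw [q2] at hk; grind)
  have v3 := hU (p 3) (by intro k hk; rw [q3] at hk; grind)
  have v4 := hU (p 4) (by intro k hk; rw [q4] at hk; grind)
  have v5 := hU (p 5) (by intro k hk; rw [q5] at hk; grind)
  have ne : ∀ i j, i ≠ j → p i ≠ p j := fun i j hij h => hij (inj i j h)
  have two : ∀ {i a b}, Uniq col d i → adj i (p a) → adj i (p b) → a ≠ b →
      col (p a) = some d → col (p b) = some d → False := by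
    rintro i a b ⟨j, -, -, h3⟩ ha hb hab ca cb
    exact ne a b hab ((h3 _ ha ca).trans (h3 _ hb cb).symm)
  have hh' : col h ≠ some d := by rw [hh]; simp
  -- the second vertex of the strip or its neighbours carry a guard
  have no2 : ∀ a, adj (p 2) (p a) → col (p a) = some d → a = 0 ∨ a = 1 ∨ a = 2 := by
    intro a ha ca
    by_contra! hn
    obtain ⟨j, h1, h2, h3⟩ := v1
    rw [q1] at h1
    rcases h1 with rfl | rfl | rfl | rfl
    · exact hh' h2
    · exact two v2 ha (by rw [q2]; simp) hn.1 ca h2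
    · exact two v2 ha (by rw [q2]; simp) hn.2.1 ca h2
    · exact two v2 ha (by rw [q2]; simp) hn.2.2 ca h2
  have no4 : ∀ a, adj (p 4) (p a) → col (p a) = some d → a = 4 ∨ a = 5 ∨ a = 6 := by
    intro a ha ca
    by_contra! hn
    obtain ⟨j, h1, h2, h3⟩ := v5
    rw [q5] at h1
    rcases h1 with rfl | rfl | rfl | rfl
    · exact hh' h2
    · exact two v4 ha (by rw [q4]; simp) hn.1 ca h2
    · exact two v4 ha (by rw [q4]; simp) hn.2.1 ca h2
    · exact two v4 ha (by rw [q4]; simp) hn.2.2 ca h2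
  obtain ⟨j, h1, h2, h3⟩ := v3
  rw [q3] at h1
  rcases h1 with rfl | rfl | rfl | rfl | rfl | rfl
  · exact hh' h2
  · have := no4 0 (by rw [q4]; simp) h2; revert this; decide
  · have := no4 2 (by rw [q4]; simp) h2; revert this; decide
  · have := no4 3 (by rw [q4]; simp) h2; revert this; decide
  · have := no2 4 (by rw [q2]; simp) h2; revert this; decide
  · have := no2 6 (by rw [q2]; simp) h2; revert this; decide

/-- A hub with two disjoint pockets is a guard. -/
theorem hub_guard {col : Fin 48 → Option (Fin 2)} {h : Fin 48} {p p' : Fin 7 → Fin 48}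
    (hp : IsPocket h p) (hp' : IsPocket h p') (hd : ∀ i j, p i ≠ p' j)
    (hcol : ∀ i, ∃ c, Uniq col c i) : ∃ c, col h = some c := by
  by_contra! hn
  have hh : col h = none := Option.eq_none_iff_forall_ne_some.mpr hn
  obtain ⟨c, x, -, -, h3⟩ := hcol h
  by_cases hx : ∃ i, x = p i
  · obtain ⟨i, rfl⟩ := hx
    exact pocket_false hp' hcol hh c fun j hj => hd i j (h3 _ (hp'.1 j) hj).symm
  · push Not at hx
    exact pocket_false hp hcol hh c fun j hj => hx j (h3 _ (hp.1 j) hj).symm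

/-- `t` sees the hubs `a`, `b`, but not the hub `e`, and everything seen from `t` is seen from
`a` and from `b`. -/
def IsEar (a b e t : Fin 48) : Prop :=
  a ≠ b ∧ adj t a ∧ adj t b ∧ ¬ adj t e ∧ adj a b ∧ adj a e ∧ ∀ k, adj t k → adj a k ∧ adj b k

instance (a b e t : Fin 48) : Decidable (IsEar a b e t) := by
  unfold IsEar
  infer_instance

/-- If both hubs of an ear have the same colour, a vertex seen from the ear has the other colour,
and is the only vertex with that colour in view of either hub. -/
theorem ear_other {col : Fin 48 → Option (Fin 2)} {a b e t : Fin 48} (he : IsEar a b e t)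
    (hcol : ∀ i, ∃ c, Uniq col c i) {c d : Fin 2} (hcd : ∀ x, x ≠ c → x = d)
    (ha : col a = some c) (hb : col b = some c) :
    ∃ y, adj t y ∧ col y = some d ∧ (∀ k, adj a k → col k = some d → k = y) ∧
      (∀ k, adj b k → col k = some d → k = y) := by
  obtain ⟨hab, ta, tb, -, aab, -, hk⟩ := he
  have other : ∀ i, adj i a → adj i b → Uniq col d i := by
    intro i ia ib
    obtain ⟨x, j, h1, h2, h3⟩ := hcol i
    have : x = d := by
      apply hcd
      rintro rfl
      exact hab ((h3 a ia ha).trans (h3 b ib hb).symm)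
    subst this
    exact ⟨j, h1, h2, h3⟩
  have aa : adj a a := (hk a ta).1
  have bb : adj b b := (hk b tb).2
  obtain ⟨y, y1, y2, -⟩ := other t ta tb
  obtain ⟨ya, yb⟩ := hk y y1
  obtain ⟨u, -, -, u3⟩ := other a aa aab
  obtain ⟨v, -, -, v3⟩ := other b (adj_symm _ _ aab) bb
  refine ⟨y, y1, y2, fun k k1 k2 => ?_, fun k k1 k2 => ?_⟩
  · exact (u3 k k1 k2).trans (u3 y ya y2).symm
  · exact (v3 k k1 k2).trans (v3 y yb y2).symm

theorem ear_third {col : Fin 48 → Option (Fin 2)} {a b e t : Fin 48} (he : IsEar a b e t)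
    (hcol : ∀ i, ∃ c, Uniq col c i) {c d : Fin 2} (hcd : ∀ x, x ≠ c → x = d)
    (ha : col a = some c) (hb : col b = some c) : col e ≠ some d := by
  intro h
  obtain ⟨y, y1, y2, y3, -⟩ := ear_other he hcol hcd ha hb
  have := y3 e he.2.2.2.2.2.1 h
  subst this
  exact he.2.2.2.1 y1

theorem pocketA : IsPocket 15 ![46, 45, 44, 43, 42, 41, 40] := by decide +kernel

theorem pocketB : IsPocket 15 ![39, 38, 37, 36, 35, 34, 33] := by decide +kernel

theorem pocketC : IsPocket 47 ![1, 2, 3, 4, 5, 6, 7] := by decide +kernel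

theorem pocketD : IsPocket 47 ![8, 9, 10, 11, 12, 13, 14] := by decide +kernel

theorem pocketE : IsPocket 17 ![32, 31, 30, 29, 28, 27, 26] := by decide +kernel

theorem pocketF : IsPocket 17 ![25, 24, 23, 22, 21, 20, 19] := by decide +kernel

theorem ear12 : IsEar 15 47 17 0 := by decide +kernel

theorem ear13 : IsEar 15 17 47 16 := by decide +kernel

theorem ear23 : IsEar 47 17 15 18 := by decide +kernel

theorem ears_disjoint : ∀ k, adj 0 k → adj 16 k → adj 18 k → False := by decide +kernel

theorem no_colouring (col : Fin 48 → Option (Fin 2)) (hcol : ∀ i, ∃ c, Uniq col c i) : False := by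
  obtain ⟨c1, e1⟩ := hub_guard pocketA pocketB (by decide) hcol
  obtain ⟨c2, e2⟩ := hub_guard pocketC pocketD (by decide) hcol
  obtain ⟨c3, e3⟩ := hub_guard pocketE pocketF (by decide) hcol
  have oth : ∀ c : Fin 2, ∃ d, d ≠ c ∧ ∀ x, x ≠ c → x = d := by decide
  have key : ∀ x y z : Fin 2, x = y ∨ x = z ∨ y = z := by decide
  have h12 : c1 = c2 → c3 = c1 := by
    rintro rfl
    obtain ⟨d, -, hd⟩ := oth c1
    by_contra hne
    exact ear_third ear12 hcol hd e1 e2 (by rw [e3, hd c3 hne])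
  have h13 : c1 = c3 → c2 = c1 := by
    rintro rfl
    obtain ⟨d, -, hd⟩ := oth c1
    by_contra hne
    exact ear_third ear13 hcol hd e1 e3 (by rw [e2, hd c2 hne])
  have h23 : c2 = c3 → c1 = c2 := by
    rintro rfl
    obtain ⟨d, -, hd⟩ := oth c2
    by_contra hne
    exact ear_third ear23 hcol hd e2 e3 (by rw [e1, hd c1 hne])
  have hall : c2 = c1 ∧ c3 = c1 := by
    have := key c1 c2 c3
    grind
  obtain ⟨rfl, rfl⟩ := hall
  obtain ⟨d, -, hd⟩ := oth c3
  obtain ⟨y, y1, y2, y3, y4⟩ := ear_other ear12 hcol hd e1 e2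
  obtain ⟨z, z1, z2, z3, z4⟩ := ear_other ear13 hcol hd e1 e3
  obtain ⟨w, w1, w2, w3, w4⟩ := ear_other ear23 hcol hd e2 e3
  have a1 : z = y := y3 z (ear13.2.2.2.2.2.2 z z1).1 z2
  have a2 : w = y := y4 w (ear23.2.2.2.2.2.2 w w1).1 w2
  rw [a1] at z1
  rw [a2] at w1
  exact ears_disjoint y y1 z1 w1

/-- There is a simple polygon with no vertex-to-vertex
conflict-free chromatic guarding with `2` colours: for every set `G` of
vertices and every colouring `χ : G → {1,2}`, some vertex `p` has no visible
guard whose colour occurs exactly once among the guards visible from `p`. -/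
theorem exists_polygon_no_v2v_two_colours :
    ∃ P : SimplePolygon, ∀ G : Finset (ℝ × ℝ), ↑G ⊆ Set.range P.vtx →
      ∀ χ : ℝ × ℝ → Fin 2, ∃ i : Fin P.n,
        ¬ ∃ g ∈ G, P.Sees g (P.vtx i) ∧
            ∀ h ∈ G, h ≠ g → P.Sees h (P.vtx i) → χ h ≠ χ g := by
  refine ⟨poly, fun G hG χ => ?_⟩
  by_contra! hcon
  classical
  let col : Fin 48 → Option (Fin 2) := fun i =>
    if emb (pt i.1) ∈ G then some (χ (emb (pt i.1))) else none
  have hcol : ∀ i c, col i = some c ↔ emb (pt i.1) ∈ G ∧ χ (emb (pt i.1)) = c := by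
    intro i c
    by_cases h : emb (pt i.1) ∈ G <;> simp [col, h]
  refine no_colouring col fun i => ?_
  obtain ⟨g, hg, hs, hu⟩ := hcon i
  obtain ⟨j, rfl⟩ := hG hg
  refine ⟨χ (emb (pt j.1)), j, ?_, (hcol _ _).mpr ⟨hg, rfl⟩, ?_⟩
  · exact adj_symm _ _ ((sees_iff j i).mp hs)
  · intro k hk hkc
    obtain ⟨k1, k2⟩ := (hcol _ _).mp hkc
    by_contra hne
    exact hu (emb (pt k.1)) k1 (fun h => hne (poly.inj h))
      ((sees_iff k i).mpr (adj_symm _ _ hk)) k2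
end

section
/- There exists a simple polygon P that has no vertex-to-vertex conflict-free chromatic guarding with a single colour; that is, for every set G of vertices of P, some vertex p of P does not see exactly one guard of G (it sees either no guard of G or at least two guards of G). -/
namespace NoOneColour

/-- The pinwheel hexagon: `a, x, b, y, c, z`. -/
def pts : Fin 6 → ℝ × ℝ :=
  ![(0, 0), (3, -1), (1, 0), (-1, 3), (0, 1), (-1, -1)]

theorem mem_seg {a b c d : ℝ} {p : ℝ × ℝ} (h : p ∈ segment ℝ (a, b) (c, d)) :
    ∃ t : ℝ, 0 ≤ t ∧ t ≤ 1 ∧ p.1 = a + t * (c - a) ∧ p.2 = b + t * (d - b) := by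
  obtain ⟨u, v, hu, hv, huv, rfl⟩ := h
  refine ⟨v, hv, by linarith, ?_, ?_⟩
  · have : u = 1 - v := by linarith
    subst this; simp; ring
  · have : u = 1 - v := by linarith
    subst this; simp; ring

theorem seg_mem {a b c d : ℝ} {p : ℝ × ℝ} (t : ℝ) (h0 : 0 ≤ t) (h1 : t ≤ 1)
    (hx : p.1 = a + t * (c - a)) (hy : p.2 = b + t * (d - b)) :
    p ∈ segment ℝ (a, b) (c, d) := by
  refine ⟨1 - t, t, by linarith, h0, by ring, ?_⟩
  ext
  · simp [hx]; ring
  · simp [hy]; ring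

theorem pts_inj : Function.Injective pts := by
  intro i j h
  fin_cases i <;> fin_cases j <;> first | rfl | (exfalso; revert h; norm_num [pts])

theorem pts_consec (i : Fin 6) :
    segment ℝ (pts i) (pts (i + 1)) ∩ segment ℝ (pts (i + 1)) (pts (i + 1 + 1))
      = {pts (i + 1)} := by
  apply Set.Subset.antisymm
  · rintro p ⟨h1, h2⟩
    fin_cases i <;>
    · obtain ⟨t, h0, h1, hx, hy⟩ := mem_seg h1
      obtain ⟨s, h0', h1', hx', hy'⟩ := mem_seg h2
      have e : ∀ q : ℝ × ℝ, p.1 = q.1 → p.2 = q.2 → p ∈ ({q} : Set (ℝ × ℝ)) :=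
        fun q h h' => Prod.ext h h'
      apply e <;> simp [pts] <;> linarith
  · rintro p rfl
    exact ⟨right_mem_segment _ _ _, left_mem_segment _ _ _⟩

theorem pts_nonconsec (i j : Fin 6) (h1 : i ≠ j) (h2 : j ≠ i + 1) (h3 : i ≠ j + 1) :
    segment ℝ (pts i) (pts (i + 1)) ∩ segment ℝ (pts j) (pts (j + 1)) = ∅ := by
  rw [Set.eq_empty_iff_forall_notMem]
  rintro p ⟨k1, k2⟩
  fin_cases i <;> fin_cases j <;>
  first
  | exact h1 rfl
  | exact h2 rfl
  | exact h3 rfl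
  | (obtain ⟨t, h0, h1, hx, hy⟩ := mem_seg k1
     obtain ⟨s, h0', h1', hx', hy'⟩ := mem_seg k2
     linarith)

/-- The hexagon as a simple polygon. -/
def hex : SimplePolygon where
  n := 6
  three_le := by norm_num
  vtx := pts
  inj := pts_inj
  consec_edges := pts_consec
  nonconsec_edges := pts_nonconsec

/-- The open exterior, a union of three open cones. -/
def W : Set (ℝ × ℝ) := {p | (p.2 < p.1 ∧ p.1 + 3 * p.2 < 0) ∨
  (1 < p.1 + 2 * p.2 ∧ 3 < 3 * p.1 + 2 * p.2) ∨
  (2 * p.1 + p.2 < 1 ∧ 2 * p.1 + 1 < p.2)}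

/-- The open interior. -/
def V : Set (ℝ × ℝ) := {p | (p.1 < p.2 ∨ 0 < p.1 + 3 * p.2) ∧
  (p.1 + 2 * p.2 < 1 ∨ 3 * p.1 + 2 * p.2 < 3) ∧
  (1 < 2 * p.1 + p.2 ∨ p.2 < 2 * p.1 + 1)}

theorem W_open : IsOpen W := by
  unfold W
  simp only [Set.setOf_or, Set.setOf_and]
  refine IsOpen.union (IsOpen.inter ?_ ?_) (IsOpen.union (IsOpen.inter ?_ ?_) (IsOpen.inter ?_ ?_))
  all_goals exact isOpen_lt (by fun_prop) (by fun_prop)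

theorem V_open : IsOpen V := by
  unfold V
  simp only [Set.setOf_or, Set.setOf_and]
  refine IsOpen.inter (IsOpen.union ?_ ?_) (IsOpen.inter (IsOpen.union ?_ ?_) (IsOpen.union ?_ ?_))
  all_goals exact isOpen_lt (by fun_prop) (by fun_prop)

theorem VW_disj : Disjoint V W := by
  rw [Set.disjoint_left]
  rintro p ⟨h1, h2, h3⟩ (⟨h, h'⟩ | ⟨h, h'⟩ | ⟨h, h'⟩)
  · rcases h1 with h1 | h1 <;> linarith
  · rcases h2 with h1 | h1 <;> linarith
  · rcases h3 with h1 | h1 <;> linarith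

theorem V_bdd : Bornology.IsBounded V := by
  apply (Metric.isBounded_Icc ((-3, -3) : ℝ × ℝ) (3, 3)).subset
  rintro p ⟨h1, h2, h3⟩
  rcases h1 with h1 | h1 <;> rcases h2 with h2 | h2 <;> rcases h3 with h3 | h3 <;>
    refine ⟨⟨?_, ?_⟩, ⟨?_, ?_⟩⟩ <;> simp only <;> linarith

theorem edge_sub (i : Fin 6) : segment ℝ (pts i) (pts (i + 1)) ⊆ hex.boundary :=
  Set.subset_iUnion (fun i : Fin 6 => segment ℝ (pts i) (pts (i + 1))) i

theorem cover (p : ℝ × ℝ) (hp : p ∉ hex.boundary) : p ∈ V ∪ W := by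
  by_contra hc
  simp only [Set.mem_union, not_or] at hc
  obtain ⟨hV, hW⟩ := hc
  apply hp
  simp only [W, Set.mem_setOf_eq, not_or, not_and, not_lt] at hW
  obtain ⟨w1, w2, w3⟩ := hW
  by_cases c1 : p.1 < p.2 ∨ 0 < p.1 + 3 * p.2
  · by_cases c2 : p.1 + 2 * p.2 < 1 ∨ 3 * p.1 + 2 * p.2 < 3
    · have c3 : ¬ (1 < 2 * p.1 + p.2 ∨ p.2 < 2 * p.1 + 1) := fun h => hV ⟨c1, c2, h⟩
      push Not at c3
      rcases eq_or_lt_of_le c3.1 with h | h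
      · have : 0 ≤ -p.1 := by linarith
        have : -p.1 ≤ 1 := by
          by_contra hh
          have := w2 (by linarith); linarith
        refine edge_sub 3 (seg_mem (1 + p.1) ?_ ?_ ?_ ?_) <;> linarith
      · have := w3 h
        have : -p.1 ≤ 1 := by
          by_contra hh
          rcases c1 with c1 | c1 <;> linarith [w1 (by linarith)]
        refine edge_sub 4 (seg_mem (-p.1) ?_ ?_ ?_ ?_) <;> linarith
    · push Not at c2
      rcases eq_or_lt_of_le c2.1 with h | h
      · have : p.1 ≤ 3 := by
          by_contra hh
          have := w1 (by linarith); linarith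
        refine edge_sub 1 (seg_mem ((3 - p.1) / 2) ?_ ?_ ?_ ?_) <;> linarith
      · have := w2 h
        have : -1 ≤ p.1 := by
          by_contra hh
          have := w3 (by linarith); linarith
        refine edge_sub 2 (seg_mem ((1 - p.1) / 2) ?_ ?_ ?_ ?_) <;> linarith
  · push Not at c1
    rcases eq_or_lt_of_le c1.1 with h | h
    · have : -1 ≤ p.1 := by
        by_contra hh
        have := w3 (by linarith); linarith
      refine edge_sub 5 (seg_mem (1 + p.1) ?_ ?_ ?_ ?_) <;> linarith
    · have := w1 h
      have : p.1 ≤ 3 := by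
        by_contra hh
        have := w2 (by linarith); linarith
      refine edge_sub 0 (seg_mem (p.1 / 3) ?_ ?_ ?_ ?_) <;> linarith

theorem mem_region {p : ℝ × ℝ} (hp : p ∉ W) : p ∈ hex.region := by
  by_cases hB : p ∈ hex.boundary
  · exact Or.inl hB
  refine Or.inr ⟨hB, V_bdd.subset ?_⟩
  have hpV : p ∈ V := (cover p hB).resolve_right hp
  refine isPreconnected_connectedComponentIn.subset_left_of_subset_union V_open W_open VW_disj
    ?_ ⟨p, mem_connectedComponentIn hB, hpV⟩
  intro q hq
  exact cover q (connectedComponentIn_subset _ _ hq)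

theorem not_region {p : ℝ × ℝ} (d : ℝ × ℝ) (hd : d ≠ 0)
    (h : ∀ t : ℝ, 0 ≤ t → p + t • d ∉ hex.boundary) : p ∉ hex.region := by
  rintro (hp | ⟨hp, hb⟩)
  · exact h 0 le_rfl (by simpa using hp)
  · have hpre : IsPreconnected ((fun t : ℝ => p + t • d) '' Set.Ici 0) :=
      isPreconnected_Ici.image _ (by fun_prop)
    have hsub := hpre.subset_connectedComponentIn (x := p) (F := hex.boundaryᶜ)
      ⟨0, Set.mem_Ici.2 le_rfl, by simp⟩ (by rintro _ ⟨t, ht, rfl⟩; exact h t ht)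
    obtain ⟨C, hC⟩ := (hb.subset hsub).exists_norm_le
    have hdn : 0 < ‖d‖ := norm_pos_iff.2 hd
    have hC0 : 0 ≤ C := (norm_nonneg p).trans (hC p ⟨0, Set.mem_Ici.2 le_rfl, by simp⟩)
    have ht : 0 ≤ (C + ‖p‖ + 1) / ‖d‖ := by positivity
    have h1 := hC _ ⟨(C + ‖p‖ + 1) / ‖d‖, ht, rfl⟩
    have h2 : ‖((C + ‖p‖ + 1) / ‖d‖) • d‖ = C + ‖p‖ + 1 := by
      rw [norm_smul, Real.norm_of_nonneg ht]; field_simp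
    have h3 := norm_sub_le (p + ((C + ‖p‖ + 1) / ‖d‖) • d) p
    rw [add_sub_cancel_left, h2] at h3
    simp only at h1
    linarith

theorem mem_boundary {p : ℝ × ℝ} (hp : p ∈ hex.boundary) :
    ∃ i : Fin 6, p ∈ segment ℝ (pts i) (pts (i + 1)) := Set.mem_iUnion.1 hp

theorem not_sees {i j : Fin 6} (p d : ℝ × ℝ) (hd : d ≠ 0)
    (hp : p ∈ segment ℝ (pts i) (pts j))
    (h : ∀ t : ℝ, 0 ≤ t → p + t • d ∉ hex.boundary) : ¬ hex.Sees (pts i) (pts j) :=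
  fun hs => not_region d hd h (hs hp)

theorem nxc : ¬ hex.Sees (pts 1) (pts 4) := by
  refine not_sees (3 / 2, 0) (1, 0) (by simp) (seg_mem (1 / 2) ?_ ?_ ?_ ?_) ?_
  iterate 4 norm_num
  intro t ht hb
  obtain ⟨i, hi⟩ := mem_boundary hb
  fin_cases i <;>
  · obtain ⟨s, h0, h1, hx, hy⟩ := mem_seg hi
    simp at hx hy
    linarith

theorem nya : ¬ hex.Sees (pts 3) (pts 0) := by
  refine not_sees (-1 / 2, 3 / 2) (-1, 0) (by simp) (seg_mem (1 / 2) ?_ ?_ ?_ ?_) ?_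
  iterate 4 norm_num
  intro t ht hb
  obtain ⟨i, hi⟩ := mem_boundary hb
  fin_cases i <;>
  · obtain ⟨s, h0, h1, hx, hy⟩ := mem_seg hi
    simp at hx hy
    linarith

theorem nzb : ¬ hex.Sees (pts 5) (pts 2) := by
  refine not_sees (0, -1 / 2) (0, -1) (by simp) (seg_mem (1 / 2) ?_ ?_ ?_ ?_) ?_
  iterate 4 norm_num
  intro t ht hb
  obtain ⟨i, hi⟩ := mem_boundary hb
  fin_cases i <;>
  · obtain ⟨s, h0, h1, hx, hy⟩ := mem_seg hi
    simp at hx hy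
    linarith

theorem sees_symm {p q : ℝ × ℝ} (h : hex.Sees p q) : hex.Sees q p := by
  unfold SimplePolygon.Sees at *
  rwa [segment_symm]

theorem sees_edge (i : Fin 6) : hex.Sees (pts i) (pts (i + 1)) :=
  (edge_sub i).trans Set.subset_union_left

theorem sees_self (i : Fin 6) : hex.Sees (pts i) (pts i) := by
  intro p hp
  rw [segment_same] at hp
  rw [Set.mem_singleton_iff.1 hp]
  exact sees_edge i (left_mem_segment _ _ _)

theorem sab : hex.Sees (pts 0) (pts 2) := by
  intro p hp
  obtain ⟨s, h0, h1, hx, hy⟩ := mem_seg hp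
  apply mem_region
  rintro (⟨h, h'⟩ | ⟨h, h'⟩ | ⟨h, h'⟩) <;> linarith

theorem sbc : hex.Sees (pts 2) (pts 4) := by
  intro p hp
  obtain ⟨s, h0, h1, hx, hy⟩ := mem_seg hp
  apply mem_region
  rintro (⟨h, h'⟩ | ⟨h, h'⟩ | ⟨h, h'⟩) <;> linarith

theorem sca : hex.Sees (pts 4) (pts 0) := by
  intro p hp
  obtain ⟨s, h0, h1, hx, hy⟩ := mem_seg hp
  apply mem_region
  rintro (⟨h, h'⟩ | ⟨h, h'⟩ | ⟨h, h'⟩) <;> linarith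

theorem hex_main (G : Finset (ℝ × ℝ)) (hG : ↑G ⊆ Set.range pts) :
    ∃ i : Fin 6, ¬ ∃! g, g ∈ G ∧ hex.Sees g (pts i) := by
  by_contra hcon
  push Not at hcon
  have uniq : ∀ i j k : Fin 6, pts j ∈ G → pts k ∈ G → hex.Sees (pts j) (pts i) →
      hex.Sees (pts k) (pts i) → j = k := fun i j k hj hk sj sk =>
    pts_inj ((hcon i).unique ⟨hj, sj⟩ ⟨hk, sk⟩)
  have ex : ∀ i : Fin 6, ∃ j : Fin 6, pts j ∈ G ∧ hex.Sees (pts j) (pts i) := by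
    intro i
    obtain ⟨g, ⟨hg, hs⟩, -⟩ := hcon i
    obtain ⟨j, rfl⟩ := hG hg
    exact ⟨j, hg, hs⟩
  have e0 : hex.Sees (pts 0) (pts 1) := sees_edge 0
  have e1 : hex.Sees (pts 1) (pts 2) := sees_edge 1
  have e2 : hex.Sees (pts 2) (pts 3) := sees_edge 2
  have e3 : hex.Sees (pts 3) (pts 4) := sees_edge 3
  have e4 : hex.Sees (pts 4) (pts 5) := sees_edge 4
  have e5 : hex.Sees (pts 5) (pts 0) := sees_edge 5
  have ncx := fun h => nxc (sees_symm h)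
  have nay := fun h => nya (sees_symm h)
  have nbz := fun h => nzb (sees_symm h)
  -- no guard at `a`
  have a0 : pts 0 ∉ G := by
    intro h
    obtain ⟨j, hj, hs⟩ := ex 3
    fin_cases j
    · exact nay hs
    · exact absurd (uniq 0 0 1 h hj (sees_self 0) (sees_symm e0)) (by decide)
    · exact absurd (uniq 0 0 2 h hj (sees_self 0) (sees_symm sab)) (by decide)
    · exact absurd (uniq 2 0 3 h hj sab (sees_symm e2)) (by decide)
    · exact absurd (uniq 0 0 4 h hj (sees_self 0) sca) (by decide)
    · exact absurd (uniq 0 0 5 h hj (sees_self 0) e5) (by decide)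
  have b0 : pts 2 ∉ G := by
    intro h
    obtain ⟨j, hj, hs⟩ := ex 5
    fin_cases j
    · exact a0 hj
    · exact absurd (uniq 2 2 1 h hj (sees_self 2) e1) (by decide)
    · exact nbz hs
    · exact absurd (uniq 2 2 3 h hj (sees_self 2) (sees_symm e2)) (by decide)
    · exact absurd (uniq 2 2 4 h hj (sees_self 2) (sees_symm sbc)) (by decide)
    · exact absurd (uniq 4 2 5 h hj sbc (sees_symm e4)) (by decide)
  have c0 : pts 4 ∉ G := by
    intro h
    obtain ⟨j, hj, hs⟩ := ex 1
    fin_cases j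
    · exact a0 hj
    · exact absurd (uniq 0 4 1 h hj sca (sees_symm e0)) (by decide)
    · exact b0 hj
    · exact absurd (uniq 4 4 3 h hj (sees_self 4) e3) (by decide)
    · exact ncx hs
    · exact absurd (uniq 4 4 5 h hj (sees_self 4) (sees_symm e4)) (by decide)
  have xy : ¬ (pts 1 ∈ G ∧ pts 3 ∈ G) := fun h =>
    absurd (uniq 2 1 3 h.1 h.2 e1 (sees_symm e2)) (by decide)
  have yz : ¬ (pts 3 ∈ G ∧ pts 5 ∈ G) := fun h =>
    absurd (uniq 4 3 5 h.1 h.2 e3 (sees_symm e4)) (by decide)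
  have zx : ¬ (pts 5 ∈ G ∧ pts 1 ∈ G) := fun h =>
    absurd (uniq 0 5 1 h.1 h.2 e5 (sees_symm e0)) (by decide)
  have oa : pts 1 ∈ G ∨ pts 5 ∈ G := by
    obtain ⟨j, hj, hs⟩ := ex 0
    fin_cases j
    exacts [(a0 hj).elim, Or.inl hj, (b0 hj).elim, (nya hs).elim, (c0 hj).elim, Or.inr hj]
  have ob : pts 1 ∈ G ∨ pts 3 ∈ G := by
    obtain ⟨j, hj, hs⟩ := ex 2
    fin_cases j
    exacts [(a0 hj).elim, Or.inl hj, (b0 hj).elim, Or.inr hj, (c0 hj).elim, (nzb hs).elim]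
  have oc : pts 3 ∈ G ∨ pts 5 ∈ G := by
    obtain ⟨j, hj, hs⟩ := ex 4
    fin_cases j
    exacts [(a0 hj).elim, (nxc hs).elim, (b0 hj).elim, Or.inl hj, (c0 hj).elim, Or.inr hj]
  tauto

end NoOneColour

/-- There is a simple polygon with no vertex-to-vertex
conflict-free chromatic guarding with a single colour: for every set `G` of
vertices, some vertex of the polygon does not see exactly one guard of `G`. -/
theorem exists_polygon_no_v2v_one_colour :
    ∃ P : SimplePolygon, ∀ G : Finset (ℝ × ℝ), ↑G ⊆ Set.range P.vtx →
      ∃ i : Fin P.n, ¬ ∃! g, g ∈ G ∧ P.Sees g (P.vtx i) :=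
  ⟨NoOneColour.hex, NoOneColour.hex_main⟩
end

section
/- There exists a simple polygon P (the 'bowl' gadget) with two vertices p₁ and p₂ joined by an edge of P such that: (a) for every vertex-to-vertex conflict-free chromatic guarding of P with at most 2 colours, the guard set contains p₁ or p₂; and (b) the single guard set {p₁} with one colour is a valid vertex-to-vertex conflict-free chromatic guarding of P (p₁ sees every vertex of P). -/
namespace Bowl

/-- Heights of the terrain. -/
def hZ (k : ℕ) : ℤ := [14, 27, 24, 17, 28, 29, 11, 20, 9, 13, 1].getD k 1

/-- Heights of the terrain, as reals. -/
noncomputable def hR (k : ℕ) : ℝ := (hZ k : ℝ)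

theorem hZ_pos (k : ℕ) : 1 ≤ hZ k := by
  by_cases hk : k < 11
  · revert k; decide
  · have : hZ k = 1 := by
      unfold hZ
      rw [List.getD_eq_default]
      simp; omega
    omega

theorem hR_pos (k : ℕ) : 1 ≤ hR k := by
  unfold hR; exact_mod_cast hZ_pos k

/-- Terrain vertex in projective coordinates. -/
noncomputable def w (k : ℕ) : ℝ × ℝ := ((k : ℝ) / hR k, 1 / hR k)

/-- The linear function of sector `k`. -/
noncomputable def L (k : ℕ) (z : ℝ × ℝ) : ℝ :=
  hR k * ((k + 1) * z.2 - z.1) + hR (k + 1) * (z.1 - k * z.2)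

theorem mem_edge (k : ℕ) (z : ℝ × ℝ) :
    z ∈ segment ℝ (w k) (w (k + 1)) ↔
      k * z.2 ≤ z.1 ∧ z.1 ≤ (k + 1) * z.2 ∧ L k z = 1 := by
  have h1 := hR_pos k
  have h2 := hR_pos (k + 1)
  have e1 : hR k ≠ 0 := by linarith
  have e2 : hR (k + 1) ≠ 0 := by linarith
  constructor
  · rintro ⟨a, b, ha, hb, hab, rfl⟩
    have a1 : 0 ≤ a / hR k := by positivity
    have b1 : 0 ≤ b / hR (k + 1) := by positivity
    refine ⟨?_, ?_, ?_⟩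
    · have : (a • w k + b • w (k + 1)).1 - k * (a • w k + b • w (k + 1)).2 = b / hR (k + 1) := by
        simp [w]; field_simp; ring
      linarith
    · have : (k + 1) * (a • w k + b • w (k + 1)).2 - (a • w k + b • w (k + 1)).1 = a / hR k := by
        simp [w]; field_simp; ring
      linarith
    · rw [← hab]; simp [w, L]; field_simp; ring
  · rintro ⟨h3, h4, h5⟩
    refine ⟨hR k * ((k + 1) * z.2 - z.1), hR (k + 1) * (z.1 - k * z.2), ?_, ?_, h5, ?_⟩
    · exact mul_nonneg (by linarith) (by linarith)
    · exact mul_nonneg (by linarith) (by linarith)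
    · ext <;> simp [w] <;> field_simp <;> ring

theorem mem_spoke (k : ℕ) (z : ℝ × ℝ) :
    z ∈ segment ℝ (w k) 0 ↔ z.1 = k * z.2 ∧ 0 ≤ z.2 ∧ hR k * z.2 ≤ 1 := by
  have h1 := hR_pos k
  have e1 : hR k ≠ 0 := by linarith
  constructor
  · rintro ⟨a, b, ha, hb, hab, rfl⟩
    have a1 : 0 ≤ a / hR k := by positivity
    refine ⟨?_, ?_, ?_⟩
    · simp [w]; field_simp
    · simp [w]; positivity
    · simp [w]; field_simp; linarith
  · rintro ⟨h3, h4, h5⟩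
    refine ⟨hR k * z.2, 1 - hR k * z.2, by positivity, by linarith, by ring, ?_⟩
    ext <;> simp [w] <;> field_simp
    linarith

theorem edge_pos {k : ℕ} {z : ℝ × ℝ} (h : z ∈ segment ℝ (w k) (w (k + 1))) : 0 < z.2 := by
  obtain ⟨h1, h2, h3⟩ := (mem_edge k z).1 h
  have : 0 ≤ z.2 := by linarith
  rcases this.lt_or_eq with h | h
  · exact h
  · exfalso
    rw [← h] at h1 h2
    have : z.1 = 0 := by linarith
    rw [L, this, ← h] at h3
    norm_num at h3

theorem edge_left {k : ℕ} {z : ℝ × ℝ} (h : z ∈ segment ℝ (w k) (w (k + 1)))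
    (hz : z.1 ≤ k * z.2) : z = w k := by
  obtain ⟨h1, h2, h3⟩ := (mem_edge k z).1 h
  have e : z.1 = k * z.2 := le_antisymm hz h1
  have h1 := hR_pos k
  have e1 : hR k ≠ 0 := by linarith
  have : hR k * z.2 = 1 := by rw [← h3, L, e]; ring
  ext
  · rw [e]; simp only [w]; field_simp; linear_combination (k : ℝ) * this
  · simp only [w]; field_simp; rw [← this]; ring

theorem edge_right {k : ℕ} {z : ℝ × ℝ} (h : z ∈ segment ℝ (w k) (w (k + 1)))
    (hz : (k + 1) * z.2 ≤ z.1) : z = w (k + 1) := by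
  obtain ⟨h1, h2, h3⟩ := (mem_edge k z).1 h
  have e : z.1 = (k + 1) * z.2 := le_antisymm h2 hz
  have h1 := hR_pos (k + 1)
  have e1 : hR (k + 1) ≠ 0 := by linarith
  have : hR (k + 1) * z.2 = 1 := by rw [← h3, L, e]; ring
  ext
  · rw [e]; simp only [w]; push_cast; field_simp; linear_combination this
  · simp only [w]; field_simp; rw [← this]; ring

/-- The vertices. -/
noncomputable def V (i : Fin 12) : ℝ × ℝ := if i.val < 11 then w i.val else 0

theorem w_inj {i j : ℕ} (h : w i = w j) : i = j := by
  have h1 := hR_pos i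
  have h2 := hR_pos j
  have e1 : hR i ≠ 0 := by linarith
  have e2 : hR j ≠ 0 := by linarith
  have a := congrArg Prod.fst h
  have b := congrArg Prod.snd h
  simp only [w] at a b
  have c : hR i = hR j := by field_simp at b; linarith
  rw [c] at a
  field_simp at a
  exact_mod_cast a

theorem w_ne (i : ℕ) : w i ≠ 0 := by
  intro h
  have h1 := hR_pos i
  have b := congrArg Prod.snd h
  simp only [w, Prod.snd_zero] at b
  have : 0 < 1 / hR i := by positivity
  linarith

theorem V_inj : Function.Injective V := by
  intro i j h
  unfold V at h
  split_ifs at h with h1 h2 h2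
  · exact Fin.ext (w_inj h)
  · exact absurd h (w_ne _)
  · exact absurd h.symm (w_ne _)
  · apply Fin.ext; omega

theorem V_lt {i : Fin 12} (h : i.val < 11) : V i = w i.val := by simp [V, h]

theorem val_succ {i : Fin 12} (h : i.val < 11) : (i + 1).val = i.val + 1 := by
  revert i; decide

theorem edge_lt {i : Fin 12} (h : i.val < 10) :
    segment ℝ (V i) (V (i + 1)) = segment ℝ (w i.val) (w (i.val + 1)) := by
  have := val_succ (i := i) (by omega)
  rw [V_lt (by omega), V_lt (by omega), this]

theorem edge_10 {i : Fin 12} (h : i.val = 10) :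
    segment ℝ (V i) (V (i + 1)) = segment ℝ (w 10) 0 := by
  obtain rfl : i = 10 := Fin.ext h
  simp [V]

theorem edge_11 {i : Fin 12} (h : i.val = 11) :
    segment ℝ (V i) (V (i + 1)) = segment ℝ (w 0) 0 := by
  obtain rfl : i = 11 := Fin.ext h
  rw [segment_symm]; simp [V]

theorem edge_disj {i j : Fin 12} (hij : i.val < j.val) (h1 : j ≠ i + 1) (h2 : i ≠ j + 1) :
    segment ℝ (V i) (V (i + 1)) ∩ segment ℝ (V j) (V (j + 1)) = ∅ := by
  have h1' : j.val ≠ i.val + 1 := by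
    intro h; apply h1; apply Fin.ext; rw [val_succ (by omega)]; exact h
  have h2' : ¬ (i.val = 0 ∧ j.val = 11) := by
    rintro ⟨a, b⟩; apply h2
    obtain rfl : i = 0 := Fin.ext a
    obtain rfl : j = 11 := Fin.ext b
    decide
  have hi : i.val < 10 := by omega
  rw [Set.eq_empty_iff_forall_notMem]
  rintro z ⟨ha, hb⟩
  rw [edge_lt hi] at ha
  have hp := edge_pos ha
  obtain ⟨a1, a2, -⟩ := (mem_edge _ z).1 ha
  rcases (by omega : j.val < 10 ∨ j.val = 10 ∨ j.val = 11) with hj | hj | hj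
  · rw [edge_lt hj] at hb
    obtain ⟨b1, b2, -⟩ := (mem_edge _ z).1 hb
    have : ((i.val : ℝ) + 2) ≤ j.val := by exact_mod_cast (by omega : i.val + 2 ≤ j.val)
    nlinarith
  · rw [edge_10 hj] at hb
    obtain ⟨b1, -⟩ := (mem_spoke _ z).1 hb
    have : ((i.val : ℝ) + 2) ≤ (10 : ℕ) := by exact_mod_cast (by omega : i.val + 2 ≤ 10)
    nlinarith
  · rw [edge_11 hj] at hb
    obtain ⟨b1, -⟩ := (mem_spoke _ z).1 hb
    have : (1 : ℝ) ≤ i.val := by exact_mod_cast (by omega : 1 ≤ i.val)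
    simp at b1
    nlinarith

theorem consec (i : Fin 12) :
    segment ℝ (V i) (V (i + 1)) ∩ segment ℝ (V (i + 1)) (V (i + 1 + 1)) = {V (i + 1)} := by
  apply Set.Subset.antisymm
  · rintro z ⟨ha, hb⟩
    rw [Set.mem_singleton_iff]
    rcases (by omega : i.val < 9 ∨ i.val = 9 ∨ i.val = 10 ∨ i.val = 11) with hi | hi | hi | hi
    · have hs := val_succ (i := i) (by omega)
      rw [edge_lt (by omega)] at ha hb
      rw [V_lt (by omega), hs]
      rw [hs] at hb
      obtain ⟨b1, b2, -⟩ := (mem_edge _ z).1 hb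
      push_cast at b1
      exact edge_right ha b1
    · have hs := val_succ (i := i) (by omega)
      rw [edge_lt (by omega)] at ha
      rw [edge_10 (by omega)] at hb
      rw [V_lt (by omega), hs]
      obtain ⟨b1, -⟩ := (mem_spoke _ z).1 hb
      apply edge_right ha
      rw [hi, b1]; norm_num
    · have hs := val_succ (i := i) (by omega)
      rw [edge_10 (by omega)] at ha
      rw [edge_11 (by omega)] at hb
      obtain ⟨b1, -⟩ := (mem_spoke _ z).1 hb
      obtain ⟨a1, -⟩ := (mem_spoke _ z).1 ha
      have : ¬ (i + 1).val < 11 := by omega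
      rw [V, if_neg this]
      push_cast at a1 b1
      ext <;> simp <;> linarith
    · obtain rfl : i = 11 := Fin.ext hi
      rw [edge_11 rfl] at ha
      have e : (11 + 1 : Fin 12) = 0 := by decide
      rw [e] at hb ⊢
      rw [edge_lt (by decide)] at hb
      rw [V_lt (by decide)]
      obtain ⟨a1, -⟩ := (mem_spoke _ z).1 ha
      exact edge_left hb (by rw [a1]; rfl)
  · rintro z rfl
    exact ⟨right_mem_segment _ _ _, left_mem_segment _ _ _⟩

/-- The bowl polygon. -/
noncomputable def P : SimplePolygon where
  n := 12
  three_le := by norm_num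
  vtx := V
  inj := V_inj
  consec_edges := consec
  nonconsec_edges := by
    intro i j hij h1 h2
    rcases lt_or_gt_of_ne (fun h => hij (Fin.ext h) : i.val ≠ j.val) with h | h
    · exact edge_disj h h1 h2
    · rw [Set.inter_comm]; exact edge_disj h h2 h1

/-- Hat functions. -/
noncomputable def hat (k : ℕ) (z : ℝ × ℝ) : ℝ := max 0 (z.2 - |z.1 - k * z.2|)

/-- The gauge. -/
noncomputable def g (z : ℝ × ℝ) : ℝ := ∑ k ∈ Finset.range 11, hR k * hat k z

theorem g_cont : Continuous g := by
  unfold g hat; fun_prop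

theorem g_sector {k : ℕ} (hk : k < 10) {z : ℝ × ℝ} (h1 : k * z.2 ≤ z.1)
    (h2 : z.1 ≤ (k + 1) * z.2) : g z = L k z := by
  have hy : 0 ≤ z.2 := by linarith
  unfold g
  rw [Finset.sum_eq_add k (k + 1) (by omega)]
  · have a1 : hat k z = (k + 1) * z.2 - z.1 := by
      unfold hat
      rw [abs_of_nonneg (by linarith), max_eq_right] <;> linarith
    have a2 : hat (k + 1) z = z.1 - k * z.2 := by
      unfold hat
      push_cast
      rw [abs_of_nonpos (by linarith), max_eq_right] <;> linarith
    rw [a1, a2, L]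
  · rintro c - ⟨c1, c2⟩
    have : hat c z = 0 := by
      unfold hat
      apply max_eq_left
      rcases (by omega : c + 1 ≤ k ∨ k + 2 ≤ c) with h | h
      · have h' : (c : ℝ) + 1 ≤ k := by exact_mod_cast h
        have := le_abs_self (z.1 - c * z.2)
        nlinarith
      · have h' : (k : ℝ) + 2 ≤ c := by exact_mod_cast h
        have := neg_abs_le (z.1 - c * z.2)
        nlinarith
    rw [this, mul_zero]
  · intro h; exact absurd (Finset.mem_range.2 (by omega)) h
  · intro h; exact absurd (Finset.mem_range.2 (by omega)) h

theorem exists_sector {z : ℝ × ℝ} (h0 : 0 ≤ z.1) (h1 : z.1 ≤ 10 * z.2) :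
    ∃ k : ℕ, k < 10 ∧ k * z.2 ≤ z.1 ∧ z.1 ≤ (k + 1) * z.2 := by
  have key : ∀ m : ℕ, 1 ≤ m → z.1 ≤ m * z.2 →
      ∃ k : ℕ, k < m ∧ k * z.2 ≤ z.1 ∧ z.1 ≤ (k + 1) * z.2 := by
    intro m hm
    induction m, hm using Nat.le_induction with
    | base => intro h; exact ⟨0, by norm_num, by simpa using h0, by simpa using h⟩
    | succ m hm ih =>
      intro h
      push_cast at h
      rcases le_total z.1 (m * z.2) with h2 | h2
      · obtain ⟨k, a, b⟩ := ih h2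
        exact ⟨k, by omega, b⟩
      · exact ⟨m, by omega, h2, h⟩
  exact key 10 (by norm_num) (by exact_mod_cast h1)

/-- The point set. -/
def T : Set (ℝ × ℝ) := {z | 0 ≤ z.1 ∧ z.1 ≤ 10 * z.2 ∧ g z ≤ 1}

/-- Its interior. -/
def U : Set (ℝ × ℝ) := {z | 0 < z.1 ∧ z.1 < 10 * z.2 ∧ g z < 1}

theorem T_closed : IsClosed T := by
  have := g_cont
  have h1 : IsClosed {z : ℝ × ℝ | 0 ≤ z.1} := isClosed_le (by fun_prop) (by fun_prop)
  have h2 : IsClosed {z : ℝ × ℝ | z.1 ≤ 10 * z.2} := isClosed_le (by fun_prop) (by fun_prop)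
  have h3 : IsClosed {z : ℝ × ℝ | g z ≤ 1} := isClosed_le (by fun_prop) (by fun_prop)
  exact h1.inter (h2.inter h3)

theorem U_open : IsOpen U := by
  have := g_cont
  have h1 : IsOpen {z : ℝ × ℝ | 0 < z.1} := isOpen_lt (by fun_prop) (by fun_prop)
  have h2 : IsOpen {z : ℝ × ℝ | z.1 < 10 * z.2} := isOpen_lt (by fun_prop) (by fun_prop)
  have h3 : IsOpen {z : ℝ × ℝ | g z < 1} := isOpen_lt (by fun_prop) (by fun_prop)
  exact h1.inter (h2.inter h3)

theorem mem_boundary {z : ℝ × ℝ} : z ∈ P.boundary ↔ ∃ i : Fin 12, z ∈ segment ℝ (V i) (V (i + 1)) :=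
  Set.mem_iUnion

theorem g_left {z : ℝ × ℝ} (hy : 0 ≤ z.2) (k : ℕ) (hk : k ≤ 10) (hz : z.1 = k * z.2) :
    g z = hR k * z.2 := by
  rcases (by omega : k < 10 ∨ k = 10) with h | rfl
  · rw [g_sector h hz.ge (by rw [hz]; linarith), L, hz]; ring
  · push_cast at hz
    rw [g_sector (k := 9) (by norm_num) (by rw [hz]; push_cast; linarith)
      (by rw [hz]; push_cast; linarith), L, hz]
    push_cast; ring

theorem boundary_sub : P.boundary ⊆ T := by
  intro z hz
  obtain ⟨i, hi⟩ := mem_boundary.1 hz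
  rcases (by omega : i.val < 10 ∨ i.val = 10 ∨ i.val = 11) with hj | hj | hj
  · rw [edge_lt hj] at hi
    have hp := edge_pos hi
    obtain ⟨b1, b2, b3⟩ := (mem_edge _ z).1 hi
    have : (i.val : ℝ) + 1 ≤ 10 := by exact_mod_cast (by omega : i.val + 1 ≤ 10)
    refine ⟨le_trans (by positivity) b1, by nlinarith, ?_⟩
    rw [g_sector hj b1 b2, b3]
  · rw [edge_10 hj] at hi
    obtain ⟨b1, b2, b3⟩ := (mem_spoke _ z).1 hi
    refine ⟨by rw [b1]; positivity, by rw [b1]; norm_num, ?_⟩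
    rwa [g_left b2 10 le_rfl b1]
  · rw [edge_11 hj] at hi
    obtain ⟨b1, b2, b3⟩ := (mem_spoke _ z).1 hi
    refine ⟨by rw [b1]; positivity, by rw [b1]; push_cast; linarith, ?_⟩
    rwa [g_left b2 0 (by norm_num) b1]

theorem T_sub : T ⊆ U ∪ P.boundary := by
  rintro z ⟨h1, h2, h3⟩
  have hy : 0 ≤ z.2 := by linarith
  rcases h1.lt_or_eq with h1' | h1'
  · rcases h2.lt_or_eq with h2' | h2'
    · rcases h3.lt_or_eq with h3' | h3'
      · exact Or.inl ⟨h1', h2', h3'⟩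
      · right
        obtain ⟨k, hk, a, b⟩ := exists_sector h1 h2
        refine mem_boundary.2 ⟨⟨k, by omega⟩, ?_⟩
        rw [edge_lt hk]
        refine (mem_edge k z).2 ⟨a, b, ?_⟩
        rw [← g_sector hk a b, h3']
    · right
      refine mem_boundary.2 ⟨10, ?_⟩
      rw [edge_10 rfl]
      have h2'' : z.1 = (10 : ℕ) * z.2 := by rw [h2']; norm_num
      refine (mem_spoke _ z).2 ⟨h2'', hy, ?_⟩
      rwa [← g_left hy 10 le_rfl h2'']
  · right
    refine mem_boundary.2 ⟨11, ?_⟩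
    rw [edge_11 rfl]
    have h2'' : z.1 = (0 : ℕ) * z.2 := by rw [← h1']; norm_num
    refine (mem_spoke _ z).2 ⟨h2'', hy, ?_⟩
    rwa [← g_left hy 0 (by norm_num) h2'']

theorem g_ge {z : ℝ × ℝ} (h0 : 0 ≤ z.1) (h1 : z.1 ≤ 10 * z.2) : z.2 ≤ g z := by
  obtain ⟨k, hk, a, b⟩ := exists_sector h0 h1
  rw [g_sector hk a b, L]
  have h1 := hR_pos k
  have h2 := hR_pos (k + 1)
  nlinarith

theorem T_bdd : Bornology.IsBounded T := by
  apply (Metric.isBounded_Icc ((0, 0) : ℝ × ℝ) (10, 1)).subset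
  rintro z ⟨h1, h2, h3⟩
  have := g_ge h1 h2
  refine ⟨⟨h1, ?_⟩, ⟨?_, ?_⟩⟩ <;> simp <;> linarith

theorem g_smul {t : ℝ} (ht : 0 ≤ t) (z : ℝ × ℝ) : g (t • z) = t * g z := by
  unfold g
  rw [Finset.mul_sum]
  apply Finset.sum_congr rfl
  intro k _
  have : hat k (t • z) = t * hat k z := by
    have e : t * z.2 - |t * z.1 - k * (t * z.2)| = t * (z.2 - |z.1 - k * z.2|) := by
      rw [show t * z.1 - k * (t * z.2) = t * (z.1 - k * z.2) by ring, abs_mul, abs_of_nonneg ht]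
      ring
    change max 0 (t * z.2 - |t * z.1 - k * (t * z.2)|) = t * max 0 (z.2 - |z.1 - k * z.2|)
    rw [e, mul_max_of_nonneg _ _ ht, mul_zero]
  rw [this]; ring

theorem T_star {z : ℝ × ℝ} (hz : z ∈ T) {t : ℝ} (h0 : 0 ≤ t) (h1 : t ≤ 1) : t • z ∈ T := by
  obtain ⟨a, b, c⟩ := hz
  refine ⟨?_, ?_, ?_⟩
  · exact mul_nonneg h0 a
  · simp; nlinarith
  · rw [g_smul h0]
    have := g_ge a b
    nlinarith

theorem region_eq : P.region = T := by
  ext z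
  constructor
  · rintro (hz | ⟨hz, hb⟩)
    · exact boundary_sub hz
    · by_contra hT
      have hz0 : z ≠ 0 := by
        rintro rfl
        apply hz
        refine mem_boundary.2 ⟨10, ?_⟩
        rw [edge_10 rfl]
        exact right_mem_segment _ _ _
      let R : Set (ℝ × ℝ) := (fun t : ℝ => t • z) '' Set.Ici 1
      have hR : IsPreconnected R :=
        (isPreconnected_Ici).image _ (by fun_prop)
      have hRT : R ⊆ P.boundaryᶜ := by
        rintro _ ⟨t, ht, rfl⟩ hbd
        apply hT
        have ht' : (1 : ℝ) ≤ t := ht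
        have := T_star (boundary_sub hbd) (t := t⁻¹) (by positivity) (inv_le_one_of_one_le₀ ht')
        simpa [smul_smul, inv_mul_cancel₀ (by linarith : t ≠ 0)] using this
      have hzR : z ∈ R := ⟨1, by simp, by simp⟩
      have hsub := hR.subset_connectedComponentIn hzR hRT
      obtain ⟨C, hC⟩ := (hb.subset hsub).exists_norm_le
      have hn : 0 < ‖z‖ := norm_pos_iff.2 hz0
      have hC0 : ‖z‖ ≤ C := hC z hzR
      have hCz : 0 ≤ C / ‖z‖ := div_nonneg (by linarith) hn.le
      have := hC _ ⟨C / ‖z‖ + 1, by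
        exact (by linarith : (1 : ℝ) ≤ C / ‖z‖ + 1), rfl⟩
      rw [norm_smul, Real.norm_of_nonneg (by positivity)] at this
      have e : (C / ‖z‖ + 1) * ‖z‖ = C + ‖z‖ := by field_simp
      linarith
  · intro hz
    by_cases hb : z ∈ P.boundary
    · exact Or.inl hb
    · refine Or.inr ⟨hb, T_bdd.subset ?_⟩
      have hU : z ∈ U := (T_sub hz).resolve_right hb
      have hpre : IsPreconnected (connectedComponentIn P.boundaryᶜ z) :=
        isPreconnected_connectedComponentIn
      have hUT : U ⊆ T := fun y hy => ⟨hy.1.le, hy.2.1.le, hy.2.2.le⟩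
      refine (hpre.subset_left_of_subset_union U_open T_closed.isOpen_compl ?_ ?_ ?_).trans hUT
      · exact Set.disjoint_left.2 fun y hy hy' => hy' (hUT hy)
      · intro y hy
        by_cases hyT : y ∈ T
        · exact Or.inl ((T_sub hyT).resolve_right (connectedComponentIn_subset _ _ hy))
        · exact Or.inr hyT
      · exact ⟨z, mem_connectedComponentIn hb, hU⟩

theorem sees_of {i j : ℕ} (hij : i < j) (hj : j ≤ 10)
    (H : ∀ k, i ≤ k → k ≤ j → hR k * (j - i) ≤ hR i * (j - k) + hR j * (k - i)) :
    P.Sees (w i) (w j) := by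
  unfold SimplePolygon.Sees
  rw [region_eq]
  rintro z ⟨a, b, ha, hb, hab, rfl⟩
  have h1 := hR_pos i
  have h2 := hR_pos j
  have e1 : hR i ≠ 0 := by linarith
  have e2 : hR j ≠ 0 := by linarith
  obtain ⟨α, hα⟩ : ∃ α, α = a / hR i := ⟨_, rfl⟩
  obtain ⟨β, hβ⟩ : ∃ β, β = b / hR j := ⟨_, rfl⟩
  have hα0 : 0 ≤ α := by rw [hα]; positivity
  have hβ0 : 0 ≤ β := by rw [hβ]; positivity
  have hs : hR i * α + hR j * β = 1 := by
    rw [hα, hβ, ← hab]; field_simp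
  obtain ⟨z, hz⟩ : ∃ z, z = a • w i + b • w j := ⟨_, rfl⟩
  rw [← hz]
  have hx : z.1 = α * i + β * j := by rw [hz, hα, hβ]; simp [w]; ring
  have hy : z.2 = α + β := by rw [hz, hα, hβ]; simp [w]; ring
  have hij' : (i : ℝ) < j := by exact_mod_cast hij
  have hj' : (j : ℝ) ≤ 10 := by exact_mod_cast hj
  have hi0 : (0 : ℝ) ≤ i := by positivity
  have hypos : 0 < z.2 := by
    rw [hy]
    by_contra hc
    have : α = 0 := by linarith
    have : β = 0 := by linarith
    rw [‹α = 0›, ‹β = 0›] at hs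
    norm_num at hs
  have x1 : i * z.2 ≤ z.1 := by rw [hx, hy]; nlinarith
  have x2 : z.1 ≤ j * z.2 := by rw [hx, hy]; nlinarith
  have x0 : 0 ≤ z.1 := le_trans (by positivity) x1
  have x10 : z.1 ≤ 10 * z.2 := by nlinarith
  refine ⟨x0, x10, ?_⟩
  have fin : ∀ k : ℕ, k < 10 → i ≤ k → k + 1 ≤ j → k * z.2 ≤ z.1 → z.1 ≤ (k + 1) * z.2 →
      g z ≤ 1 := by
    intro k hk hik hkj s1 s2
    rw [g_sector hk s1 s2]
    have H1 := mul_le_mul_of_nonneg_right (H k hik (by omega)) (sub_nonneg.2 s2)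
    have H2 := mul_le_mul_of_nonneg_right (H (k + 1) (by omega) hkj) (sub_nonneg.2 s1)
    push_cast at H2
    have e : (hR i * (j - k) + hR j * (k - i)) * ((k + 1) * z.2 - z.1) +
        (hR i * (j - (k + 1)) + hR j * (k + 1 - i)) * (z.1 - k * z.2) = (j - i) * 1 := by
      rw [hx, hy]; linear_combination ((j : ℝ) - i) * hs
    have : ((j : ℝ) - i) * L k z ≤ (j - i) * 1 := by
      rw [← e, L]; linarith
    exact le_of_mul_le_mul_left this (by linarith)
  obtain ⟨k, hk, s1, s2⟩ := exists_sector x0 x10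
  rcases (by omega : (i ≤ k ∧ k + 1 ≤ j) ∨ k + 1 ≤ i ∨ j ≤ k) with h | h | h
  · exact fin k hk h.1 h.2 s1 s2
  · have : (k : ℝ) + 1 ≤ i := by exact_mod_cast h
    refine fin i (by omega) le_rfl (by omega) x1 ?_
    nlinarith
  · have : (j : ℝ) ≤ k := by exact_mod_cast h
    obtain ⟨j, rfl⟩ : ∃ l, j = l + 1 := ⟨j - 1, by omega⟩
    push_cast at *
    refine fin j (by omega) (by omega) le_rfl ?_ x2
    nlinarith

theorem not_sees_of {i j k : ℕ} (hik : i < k) (hkj : k < j) (hj : j ≤ 10)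
    (H : hR i * (j - k) + hR j * (k - i) < hR k * (j - i)) :
    ¬ P.Sees (w i) (w j) := by
  unfold SimplePolygon.Sees
  rw [region_eq]
  intro hs
  have h1 := hR_pos i
  have h2 := hR_pos j
  have e1 : hR i ≠ 0 := by linarith
  have e2 : hR j ≠ 0 := by linarith
  have i1 : (0 : ℝ) < k - i := sub_pos.2 (by exact_mod_cast hik)
  have i2 : (0 : ℝ) < j - k := sub_pos.2 (by exact_mod_cast hkj)
  obtain ⟨D, hD⟩ : ∃ D, D = hR i * (j - k) + hR j * (k - i) := ⟨_, rfl⟩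
  have hD0 : 0 < D := by rw [hD]; positivity
  have hD' : D ≠ 0 := hD0.ne'
  have hm : (hR i * (j - k) / D) • w i + (hR j * (k - i) / D) • w j ∈ segment ℝ (w i) (w j) :=
    ⟨_, _, by positivity, by positivity, by rw [← add_div, ← hD, div_self hD'], rfl⟩
  have hz : (hR i * (j - k) / D) • w i + (hR j * (k - i) / D) • w j
      = ((k : ℝ) * ((j - i) / D), ((j : ℝ) - i) / D) := by
    ext <;> simp [w] <;> field_simp <;> ring
  rw [hz] at hm
  obtain ⟨-, -, hg⟩ := hs hm
  have y0 : (0 : ℝ) ≤ (j - i) / D := div_nonneg (by linarith) hD0.le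
  rw [g_left (k := k) y0 (by omega) rfl] at hg
  rw [← hD] at H
  have : hR k * (((j : ℝ) - i) / D) = hR k * (j - i) / D := by ring
  simp only [this] at hg
  rw [div_le_one hD0] at hg
  linarith

/-- Visibility rows (bit masks) of the twelve vertices. -/
def row (v : Fin 12) : ℕ :=
  (![2051, 2103, 2078, 2076, 2110, 2802, 2272, 3040, 2944, 4000, 3584, 4095] : Fin 12 → ℕ) v

theorem row_spec : ∀ i j : Fin 11, i < j →
    ((row i.castSucc).testBit j.val = true ↔
      ∀ k : Fin 11, i ≤ k → k ≤ j →
        hZ k * ((j.val : ℤ) - i.val) ≤ hZ i * ((j.val : ℤ) - k.val) + hZ j * ((k.val : ℤ) - i.val)) := by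
  decide +kernel

theorem sees_iff_lt (i j : Fin 11) (hij : i < j) :
    P.Sees (w i) (w j) ↔ (row i.castSucc).testBit j.val = true := by
  rw [row_spec i j hij]
  have hj := j.isLt
  constructor
  · intro h
    by_contra hc
    push Not at hc
    obtain ⟨k, h1, h2, h3⟩ := hc
    have hR3 : hR i * (j.val - k.val) + hR j * (k.val - i.val) < hR k * (j.val - i.val) := by
      unfold hR; exact_mod_cast h3
    refine not_sees_of (k := k.val) ?_ ?_ (by omega) hR3 h
    · rcases h1.lt_or_eq with h | h
      · exact h
      · subst h; exact absurd hR3 (by ring_nf; exact lt_irrefl _)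
    · rcases h2.lt_or_eq with h | h
      · exact h
      · subst h; exact absurd hR3 (by ring_nf; exact lt_irrefl _)
  · intro h
    refine sees_of hij (by omega) ?_
    intro k h1 h2
    have := h ⟨k, by omega⟩ h1 h2
    simp only at this
    unfold hR
    exact_mod_cast this

theorem vtx_mem_T (i : Fin 12) : V i ∈ T :=
  boundary_sub (mem_boundary.2 ⟨i, left_mem_segment _ _ _⟩)

theorem sees_symm {p q : ℝ × ℝ} : P.Sees p q ↔ P.Sees q p := by
  unfold SimplePolygon.Sees; rw [segment_symm]

theorem sees_zero (i : Fin 12) : P.Sees 0 (V i) := by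
  unfold SimplePolygon.Sees
  rw [region_eq]
  rintro z ⟨a, b, ha, hb, hab, rfl⟩
  rw [smul_zero, zero_add]
  exact T_star (vtx_mem_T i) hb (by linarith)

theorem sees_self (i : Fin 12) : P.Sees (V i) (V i) := by
  unfold SimplePolygon.Sees
  rw [region_eq, segment_same]
  rintro z rfl
  exact vtx_mem_T i

theorem row_symm : ∀ i j : Fin 12, (row i).testBit j.val = (row j).testBit i.val := by
  decide +kernel

theorem row_last : ∀ i : Fin 12, (row i).testBit 11 = true := by
  decide +kernel

theorem row_self : ∀ i : Fin 12, (row i).testBit i.val = true := by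
  decide +kernel

theorem V_castSucc (i : Fin 11) : V i.castSucc = w i.val := V_lt i.isLt

theorem V_last : V 11 = 0 := by simp [V]

theorem sees_iff (i j : Fin 12) : P.Sees (V i) (V j) ↔ (row i).testBit j.val = true := by
  have key : ∀ i j : Fin 12, i < j → (P.Sees (V i) (V j) ↔ (row i).testBit j.val = true) := by
    intro i j hij
    by_cases hj : j = 11
    · subst hj
      rw [V_last, sees_symm]
      exact iff_of_true (sees_zero i) (row_last i)
    · have hj' : j.val < 11 := by
        have := j.isLt
        have : j.val ≠ 11 := fun h => hj (Fin.ext h)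
        omega
      have hij' : i.val < j.val := hij
      rw [V_lt hj', V_lt (by omega)]
      exact sees_iff_lt ⟨i.val, by omega⟩ ⟨j.val, hj'⟩ hij
  rcases lt_trichotomy i j with h | h | h
  · exact key i j h
  · subst h
    exact iff_of_true (sees_self i) (row_self i)
  · rw [sees_symm, row_symm]; exact key j i h

theorem sum12 (f : Fin 12 → ℕ) : ∑ h : Fin 12, f h = f 0 + f 1 + f 2 + f 3 + f 4 + f 5 + f 6 + f 7 + f 8 + f 9 + f 10 + f 11 := by
  simp [Fin.sum_univ_succ]; try ring_nf

theorem comb (a : Fin 12) (s : Fin 12 → ℕ) (s0 : s 0 = 0) (s11 : s 11 = 0) (ha : a ≠ 0)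
    (ha' : a ≠ 11)
    (H : ∀ v : Fin 12, (row v).testBit a.val = false →
      ∑ h : Fin 12, (if (row v).testBit h.val then s h else 0) = 1) : False := by
  have E0 : ∑ h : Fin 12, (if (row 0).testBit h.val then s h else 0) = s 1 := by
    rw [sum12, s0, s11]; simp [row, Nat.testBit, Nat.shiftRight_eq_div_pow]
  have E1 : ∑ h : Fin 12, (if (row 1).testBit h.val then s h else 0) = s 1 + s 2 + s 4 + s 5 := by
    rw [sum12, s0, s11]; simp [row, Nat.testBit, Nat.shiftRight_eq_div_pow]
  have E2 : ∑ h : Fin 12, (if (row 2).testBit h.val then s h else 0) = s 1 + s 2 + s 3 + s 4 := by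
    rw [sum12, s0, s11]; simp [row, Nat.testBit, Nat.shiftRight_eq_div_pow]
  have E3 : ∑ h : Fin 12, (if (row 3).testBit h.val then s h else 0) = s 2 + s 3 + s 4 := by
    rw [sum12, s0, s11]; simp [row, Nat.testBit, Nat.shiftRight_eq_div_pow]
  have E4 : ∑ h : Fin 12, (if (row 4).testBit h.val then s h else 0) = s 1 + s 2 + s 3 + s 4 + s 5 := by
    rw [sum12, s0, s11]; simp [row, Nat.testBit, Nat.shiftRight_eq_div_pow]
  have E5 : ∑ h : Fin 12, (if (row 5).testBit h.val then s h else 0) = s 1 + s 4 + s 5 + s 6 + s 7 + s 9 := by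
    rw [sum12, s0, s11]; simp [row, Nat.testBit, Nat.shiftRight_eq_div_pow]
  have E6 : ∑ h : Fin 12, (if (row 6).testBit h.val then s h else 0) = s 5 + s 6 + s 7 := by
    rw [sum12, s0, s11]; simp [row, Nat.testBit, Nat.shiftRight_eq_div_pow]
  have E7 : ∑ h : Fin 12, (if (row 7).testBit h.val then s h else 0) = s 5 + s 6 + s 7 + s 8 + s 9 := by
    rw [sum12, s0, s11]; simp [row, Nat.testBit, Nat.shiftRight_eq_div_pow]
  have E8 : ∑ h : Fin 12, (if (row 8).testBit h.val then s h else 0) = s 7 + s 8 + s 9 := by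
    rw [sum12, s0, s11]; simp [row, Nat.testBit, Nat.shiftRight_eq_div_pow]
  have E9 : ∑ h : Fin 12, (if (row 9).testBit h.val then s h else 0) = s 5 + s 7 + s 8 + s 9 + s 10 := by
    rw [sum12, s0, s11]; simp [row, Nat.testBit, Nat.shiftRight_eq_div_pow]
  have E10 : ∑ h : Fin 12, (if (row 10).testBit h.val then s h else 0) = s 9 + s 10 := by
    rw [sum12, s0, s11]; simp [row, Nat.testBit, Nat.shiftRight_eq_div_pow]
  fin_cases a
  · exact ha rfl
  · have h3 := E3.symm.trans (H 3 (by decide +kernel))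
    have h6 := E6.symm.trans (H 6 (by decide +kernel))
    have h7 := E7.symm.trans (H 7 (by decide +kernel))
    have h8 := E8.symm.trans (H 8 (by decide +kernel))
    have h9 := E9.symm.trans (H 9 (by decide +kernel))
    have h10 := E10.symm.trans (H 10 (by decide +kernel))
    clear H
    omega
  · have h0 := E0.symm.trans (H 0 (by decide +kernel))
    have h5 := E5.symm.trans (H 5 (by decide +kernel))
    have h6 := E6.symm.trans (H 6 (by decide +kernel))
    have h7 := E7.symm.trans (H 7 (by decide +kernel))
    have h8 := E8.symm.trans (H 8 (by decide +kernel))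
    have h9 := E9.symm.trans (H 9 (by decide +kernel))
    have h10 := E10.symm.trans (H 10 (by decide +kernel))
    clear H
    omega
  · have h0 := E0.symm.trans (H 0 (by decide +kernel))
    have h1 := E1.symm.trans (H 1 (by decide +kernel))
    have h5 := E5.symm.trans (H 5 (by decide +kernel))
    have h6 := E6.symm.trans (H 6 (by decide +kernel))
    have h7 := E7.symm.trans (H 7 (by decide +kernel))
    have h8 := E8.symm.trans (H 8 (by decide +kernel))
    have h9 := E9.symm.trans (H 9 (by decide +kernel))
    have h10 := E10.symm.trans (H 10 (by decide +kernel))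
    clear H
    omega
  · have h0 := E0.symm.trans (H 0 (by decide +kernel))
    have h6 := E6.symm.trans (H 6 (by decide +kernel))
    have h7 := E7.symm.trans (H 7 (by decide +kernel))
    have h8 := E8.symm.trans (H 8 (by decide +kernel))
    have h9 := E9.symm.trans (H 9 (by decide +kernel))
    have h10 := E10.symm.trans (H 10 (by decide +kernel))
    clear H
    omega
  · have h0 := E0.symm.trans (H 0 (by decide +kernel))
    have h2 := E2.symm.trans (H 2 (by decide +kernel))
    have h3 := E3.symm.trans (H 3 (by decide +kernel))
    have h8 := E8.symm.trans (H 8 (by decide +kernel))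
    have h10 := E10.symm.trans (H 10 (by decide +kernel))
    clear H
    omega
  · have h0 := E0.symm.trans (H 0 (by decide +kernel))
    have h1 := E1.symm.trans (H 1 (by decide +kernel))
    have h2 := E2.symm.trans (H 2 (by decide +kernel))
    have h3 := E3.symm.trans (H 3 (by decide +kernel))
    have h4 := E4.symm.trans (H 4 (by decide +kernel))
    have h8 := E8.symm.trans (H 8 (by decide +kernel))
    have h9 := E9.symm.trans (H 9 (by decide +kernel))
    have h10 := E10.symm.trans (H 10 (by decide +kernel))
    clear H
    omega
  · have h0 := E0.symm.trans (H 0 (by decide +kernel))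
    have h1 := E1.symm.trans (H 1 (by decide +kernel))
    have h2 := E2.symm.trans (H 2 (by decide +kernel))
    have h3 := E3.symm.trans (H 3 (by decide +kernel))
    have h4 := E4.symm.trans (H 4 (by decide +kernel))
    have h10 := E10.symm.trans (H 10 (by decide +kernel))
    clear H
    omega
  · have h0 := E0.symm.trans (H 0 (by decide +kernel))
    have h1 := E1.symm.trans (H 1 (by decide +kernel))
    have h2 := E2.symm.trans (H 2 (by decide +kernel))
    have h3 := E3.symm.trans (H 3 (by decide +kernel))
    have h4 := E4.symm.trans (H 4 (by decide +kernel))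
    have h5 := E5.symm.trans (H 5 (by decide +kernel))
    have h6 := E6.symm.trans (H 6 (by decide +kernel))
    have h10 := E10.symm.trans (H 10 (by decide +kernel))
    clear H
    omega
  · have h0 := E0.symm.trans (H 0 (by decide +kernel))
    have h1 := E1.symm.trans (H 1 (by decide +kernel))
    have h2 := E2.symm.trans (H 2 (by decide +kernel))
    have h3 := E3.symm.trans (H 3 (by decide +kernel))
    have h4 := E4.symm.trans (H 4 (by decide +kernel))
    have h6 := E6.symm.trans (H 6 (by decide +kernel))
    clear H
    omega
  · have h0 := E0.symm.trans (H 0 (by decide +kernel))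
    have h1 := E1.symm.trans (H 1 (by decide +kernel))
    have h2 := E2.symm.trans (H 2 (by decide +kernel))
    have h3 := E3.symm.trans (H 3 (by decide +kernel))
    have h4 := E4.symm.trans (H 4 (by decide +kernel))
    have h5 := E5.symm.trans (H 5 (by decide +kernel))
    have h6 := E6.symm.trans (H 6 (by decide +kernel))
    have h7 := E7.symm.trans (H 7 (by decide +kernel))
    have h8 := E8.symm.trans (H 8 (by decide +kernel))
    clear H
    omega
  · exact ha' rfl


theorem main_a (k : ℕ) (hk : k ≤ 2) (G : Finset (ℝ × ℝ)) (χ : ℝ × ℝ → Fin k)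
    (hG : P.IsCFGuardV2V G k χ) : V 11 ∈ G ∨ V 0 ∈ G := by
  classical
  by_contra hc
  push Not at hc
  obtain ⟨c11, c0⟩ := hc
  obtain ⟨hsub, hG⟩ := hG
  have hG' : ∀ v : Fin 12, ∃ a : Fin 12, V a ∈ G ∧ (row v).testBit a.val = true ∧
      ∀ b : Fin 12, V b ∈ G → b ≠ a → (row v).testBit b.val = true → χ (V b) ≠ χ (V a) := by
    intro v
    obtain ⟨p, hp, hs, hu⟩ := hG v
    obtain ⟨(a : Fin 12), rfl⟩ := hsub hp
    refine ⟨a, hp, ?_, ?_⟩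
    · rw [row_symm]
      exact (sees_iff a v).1 hs
    · intro b hb hba hv
      refine hu _ hb (fun h => hba (V_inj h)) ((sees_iff b v).2 ?_)
      rwa [row_symm]
  obtain ⟨a, haG, -, hau⟩ := hG' 11
  have hau' : ∀ b : Fin 12, V b ∈ G → b ≠ a → χ (V b) ≠ χ (V a) := by
    intro b hb hba
    refine hau b hb hba ?_
    have := row_last b
    rw [row_symm]; exact this
  refine comb a (fun b => if V b ∈ G then 1 else 0) (by simp [c0]) (by simp [c11])
    (by rintro rfl; exact c0 haG) (by rintro rfl; exact c11 haG) ?_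
  intro v hv
  obtain ⟨b, hbG, hvb, hbu⟩ := hG' v
  have hba : b ≠ a := by rintro rfl; rw [hv] at hvb; exact absurd hvb (by simp)
  rw [Finset.sum_eq_single b]
  · simp [hvb, hbG]
  · intro c _ hcb
    by_cases hvc : (row v).testBit c.val = true
    · by_cases hcG : V c ∈ G
      · exfalso
        have hca : c ≠ a := by rintro rfl; rw [hv] at hvc; exact absurd hvc (by simp)
        have h1 := hbu c hcG hcb hvc
        have h2 := hau' c hcG hca
        have h3 := hau' b hbG hba
        have h1' := fun h => h1 (Fin.ext h)
        have h2' := fun h => h2 (Fin.ext h)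
        have h3' := fun h => h3 (Fin.ext h)
        have l1 := (χ (V c)).isLt
        have l2 := (χ (V b)).isLt
        have l3 := (χ (V a)).isLt
        omega
      · simp [hcG]
    · simp [hvc]
  · intro h; exact absurd (Finset.mem_univ _) h

end Bowl

/-- The "bowl" gadget: there is a simple polygon `P` with two
vertices `p₁ = vtx i` and `p₂ = vtx (i+1)` joined by an edge of `P` such that
(a) every vertex-to-vertex conflict-free chromatic guarding of `P` with at
most `2` colours places a guard at `p₁` or at `p₂`, and (b) `p₁` sees every
vertex of `P`, and the single guard set `{p₁}` with one colour is a valid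
vertex-to-vertex conflict-free chromatic guarding of `P`. -/
theorem exists_bowl_gadget :
    ∃ (P : SimplePolygon) (i : Fin P.n),
      (∀ k : ℕ, k ≤ 2 → ∀ (G : Finset (ℝ × ℝ)) (χ : ℝ × ℝ → Fin k),
        P.IsCFGuardV2V G k χ → P.vtx i ∈ G ∨ P.vtx (i + 1) ∈ G) ∧
      (∀ j : Fin P.n, P.Sees (P.vtx i) (P.vtx j)) ∧
      P.IsCFGuardV2V {P.vtx i} 1 (fun _ => 0) := by
  refine ⟨Bowl.P, (11 : Fin 12), ?_, ?_, ?_⟩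
  · intro k hk G χ hG
    exact Bowl.main_a k hk G χ hG
  · intro j
    have := Bowl.sees_zero j
    rw [← Bowl.V_last] at this
    exact this
  · refine ⟨?_, ?_⟩
    · intro p hp
      rw [Finset.coe_singleton, Set.mem_singleton_iff] at hp
      exact ⟨(11 : Fin 12), hp.symm⟩
    · intro j
      refine ⟨_, Finset.mem_singleton_self _, ?_, ?_⟩
      · have := Bowl.sees_zero j
        rw [← Bowl.V_last] at this
        exact this
      · intro h hh hne
        exact absurd (Finset.mem_singleton.1 hh) hne
end
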